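/- arXiv:1609.06856 — 11 statements merged into one kernel-verified Lean document; each statement's English description precedes it below -/
import Mathlib

section
/- For every finite Borel measure ν on V with ν ≪ μ_T, there exists exactly one function β in 𝓛 (i.e., β : [0,t_f] → [0,1] nondecreasing with β(0) = 0) such that for every t ∈ [0,t_f] one has β_t = ν({(s,u,x) ∈ V : s ≤ t and β_s ≤ u}), i.e., β is the unique fixed point of the operator 𝒯_ν. -/
open MeasureTheory Set Filter
open scoped ENNReal NNReal

noncomputable section

/-- Ambient space `ℝ × ℝ × ℝ^d` hosting `V = [0,t_f] × [0,1] × W`. -/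
abbrev SpacePt (d : ℕ) := ℝ × ℝ × (Fin d → ℝ)

/-- The intensity measure `μ_T = μᵗ ⊗ Leb_{[0,1]} ⊗ μˢ`. -/
noncomputable def muT (d : ℕ) (μt : Measure ℝ) (μs : Measure (Fin d → ℝ)) :
    Measure (SpacePt d) :=
  μt.prod ((volume.restrict (Icc (0:ℝ) 1)).prod μs)

/-- Membership in `𝓛`: nondecreasing `[0,t_f] → [0,1]` vanishing at `0`. -/
def memL (tf : ℝ) (β : Icc (0:ℝ) tf → ℝ) : Prop :=
  Monotone β ∧ (∀ s : Icc (0:ℝ) tf, (s : ℝ) = 0 → β s = 0) ∧ ∀ s, β s ∈ Icc (0:ℝ) 1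

/-- `β_t(ν)(A) = ν {(s,u,x) ∈ V : s ≤ t, u ≥ β_s, x ∈ A}`; for `A = W` this is the
value `𝒯_ν(β)_t` of the integral operator `𝒯_ν`. -/
noncomputable def bMass (d : ℕ) (tf : ℝ) (ν : Measure (SpacePt d)) (β : Icc (0:ℝ) tf → ℝ)
    (t : ℝ) (A : Set (Fin d → ℝ)) : ℝ≥0∞ :=
  ν {p : SpacePt d | ∃ h : p.1 ∈ Icc (0:ℝ) tf,
      p.1 ≤ t ∧ β ⟨p.1, h⟩ ≤ p.2.1 ∧ p.2.1 ∈ Icc (0:ℝ) 1 ∧ p.2.2 ∈ A}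

/-- `β` is a fixed point of `𝒯_ν`, i.e. `β_t = ν {(s,u,x) ∈ V : s ≤ t, β_s ≤ u}`. -/
def IsFixedPt (d : ℕ) (tf : ℝ) (W : Set (Fin d → ℝ)) (ν : Measure (SpacePt d))
    (β : Icc (0:ℝ) tf → ℝ) : Prop :=
  ∀ t : Icc (0:ℝ) tf, ENNReal.ofReal (β t) = bMass d tf ν β (t : ℝ) W

/-! ### Auxiliary planar operator -/

/-- Planar version of the operator. -/
def opT (m : Measure (ℝ × ℝ)) (b : ℝ → ℝ) (t : ℝ) : ℝ :=
  m.real {p : ℝ × ℝ | p.1 ≤ t ∧ b p.1 ≤ p.2}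

lemma meas_aux {b : ℝ → ℝ} (hb : Measurable b) (t : ℝ) :
    MeasurableSet {p : ℝ × ℝ | p.1 ≤ t ∧ b p.1 ≤ p.2} :=
  (measurableSet_le measurable_fst measurable_const).inter
    (measurableSet_le (hb.comp measurable_fst) measurable_snd)

lemma real_tendsto {ι : Type*} (l : Filter ι) [l.IsCountablyGenerated] (m : Measure (ℝ × ℝ))
    [IsFiniteMeasure m] {A : Set (ℝ × ℝ)} {As : ι → Set (ℝ × ℝ)} (hA : MeasurableSet A)
    (hAs : ∀ i, MeasurableSet (As i)) (h : ∀ᵐ x ∂m, ∀ᶠ i in l, x ∈ As i ↔ x ∈ A) :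
    Tendsto (fun i => m.real (As i)) l (nhds (m.real A)) := by
  have := tendsto_measure_of_ae_tendsto_indicator_of_isFiniteMeasure l hA hAs h
  exact (ENNReal.tendsto_toReal (measure_ne_top m A)).comp this

lemma opT_mono (m : Measure (ℝ × ℝ)) [IsFiniteMeasure m] (b : ℝ → ℝ) : Monotone (opT m b) := by
  intro s t hst
  exact measureReal_mono (fun p hp => ⟨hp.1.trans hst, hp.2⟩)

lemma opT_cont (m : Measure (ℝ × ℝ)) [IsFiniteMeasure m] (h0 : ∀ t, m {p | p.1 = t} = 0)
    {b : ℝ → ℝ} (hb : Measurable b) : Continuous (opT m b) := by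
  rw [continuous_iff_continuousAt]
  intro t
  refine real_tendsto (nhds t) m (meas_aux hb t) (fun i => meas_aux hb i) ?_
  have : ∀ᵐ p ∂m, p.1 ≠ t := by
    rw [ae_iff]; simpa using h0 t
  filter_upwards [this] with p hp
  rcases lt_or_gt_of_ne hp with h | h
  · filter_upwards [lt_mem_nhds h] with i hi
    simp [hi.le, h.le]
  · filter_upwards [gt_mem_nhds h] with i hi
    simp [not_le.2 hi, not_le.2 h]

lemma opT_diff (m : Measure (ℝ × ℝ)) [IsFiniteMeasure m] {b : ℝ → ℝ} (hb : Measurable b)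
    {s t : ℝ} (hst : s ≤ t) :
    opT m b t - opT m b s = m.real {p : ℝ × ℝ | s < p.1 ∧ p.1 ≤ t ∧ b p.1 ≤ p.2} := by
  have : {p : ℝ × ℝ | s < p.1 ∧ p.1 ≤ t ∧ b p.1 ≤ p.2} =
      {p : ℝ × ℝ | p.1 ≤ t ∧ b p.1 ≤ p.2} \ {p : ℝ × ℝ | p.1 ≤ s ∧ b p.1 ≤ p.2} := by
    ext p
    simp only [mem_ofPred_eq, Set.mem_sdiff]
    constructor
    · rintro ⟨h1, h2, h3⟩
      exact ⟨⟨h2, h3⟩, fun h => absurd h.1 (not_le.2 h1)⟩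
    · rintro ⟨⟨h2, h3⟩, h⟩
      exact ⟨not_le.1 fun h' => h ⟨h', h3⟩, h2, h3⟩
  have hsub : {p : ℝ × ℝ | p.1 ≤ s ∧ b p.1 ≤ p.2} ⊆ {p : ℝ × ℝ | p.1 ≤ t ∧ b p.1 ≤ p.2} :=
    fun p hp => ⟨hp.1.trans hst, hp.2⟩
  rw [this, measureReal_sdiff hsub (meas_aux hb s)]
  rfl

lemma crossing {f : ℝ → ℝ} (hf : Continuous f) {c t : ℝ} (ht : 0 ≤ t) (h0 : f 0 ≤ c)
    (h1 : c < f t) : ∃ s, 0 ≤ s ∧ s ≤ t ∧ f s ≤ c ∧ ∀ r, s < r → r ≤ t → c < f r := by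
  have hcl : IsCompact (Icc 0 t ∩ {s | f s ≤ c}) :=
    isCompact_Icc.inter_right (isClosed_le hf continuous_const)
  obtain ⟨s, hs, hmax⟩ := hcl.exists_isGreatest ⟨0, ⟨le_refl 0, ht⟩, h0⟩
  refine ⟨s, hs.1.1, hs.1.2, hs.2, fun r hr hrt => ?_⟩
  by_contra hcon
  exact absurd (hmax ⟨⟨hs.1.1.trans hr.le, hrt⟩, not_lt.1 hcon⟩) (not_le.2 hr)

lemma opT_zero (m : Measure (ℝ × ℝ)) (hneg : m {p | p.1 ≤ 0} = 0)
    (b : ℝ → ℝ) {t : ℝ} (ht : t ≤ 0) : opT m b t = 0 := by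
  have : m {p : ℝ × ℝ | p.1 ≤ t ∧ b p.1 ≤ p.2} = 0 :=
    measure_mono_null (fun p hp => hp.1.trans ht) hneg
  simp [opT, measureReal_def, this]

lemma opT_congr (m : Measure (ℝ × ℝ)) {b b' : ℝ → ℝ} {t : ℝ} (h : ∀ s ≤ t, b s = b' s) :
    opT m b t = opT m b' t := by
  unfold opT
  congr 1
  ext p
  simp only [mem_ofPred_eq]
  constructor
  · rintro ⟨h1, h2⟩
    exact ⟨h1, by rwa [← h _ h1]⟩
  · rintro ⟨h1, h2⟩
    exact ⟨h1, by rwa [h _ h1]⟩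

/-- Comparison of approximate fixed points. -/
lemma compare (m : Measure (ℝ × ℝ)) [IsFiniteMeasure m] (h0 : ∀ t, m {p | p.1 = t} = 0)
    (hneg : m {p | p.1 ≤ 0} = 0) {b g : ℝ → ℝ} (hb : Measurable b) (hg : Measurable g)
    {tf ε : ℝ} (hε : 0 ≤ ε)
    (hbε : ∀ s, 0 ≤ s → s ≤ tf → |opT m b s - b s| ≤ ε)
    (hgε : ∀ s, 0 ≤ s → s ≤ tf → |opT m g s - g s| ≤ ε)
    {t : ℝ} (ht : 0 ≤ t) (httf : t ≤ tf) : opT m b t ≤ opT m g t + 2 * ε := by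
  by_contra hcon
  rw [not_le] at hcon
  obtain ⟨s, hs0, hst, hs, hr⟩ := crossing (f := fun r => opT m b r - opT m g r) (c := 2 * ε)
    ((opT_cont m h0 hb).sub (opT_cont m h0 hg)) ht
    (by simp [opT_zero m hneg, hε]) (by linarith)
  have key : opT m b t - opT m b s ≤ opT m g t - opT m g s := by
    rw [opT_diff m hb hst, opT_diff m hg hst]
    refine measureReal_mono ?_
    rintro p ⟨h1, h2, h3⟩
    refine ⟨h1, h2, ?_⟩
    have e1 := abs_le.1 (hbε p.1 (hs0.trans h1.le) (h2.trans httf))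
    have e2 := abs_le.1 (hgε p.1 (hs0.trans h1.le) (h2.trans httf))
    have e3 := hr p.1 h1 h2
    linarith [e1.1, e1.2, e2.1, e2.2]
  linarith

/-- Delay iteration. -/
def delayB (m : Measure (ℝ × ℝ)) (δ : ℝ) : ℕ → ℝ → ℝ
  | 0 => fun _ => 0
  | k + 1 => opT m (fun s => delayB m δ k (s - δ))

lemma delayB_mono (m : Measure (ℝ × ℝ)) [IsFiniteMeasure m] (δ : ℝ) (k : ℕ) :
    Monotone (delayB m δ k) := by
  cases k with
  | zero => exact fun _ _ _ => le_refl _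
  | succ k => exact opT_mono m _

lemma delayB_stable (m : Measure (ℝ × ℝ)) (hneg : m {p | p.1 ≤ 0} = 0) (δ : ℝ) (k : ℕ) :
    ∀ t, t ≤ k * δ → delayB m δ (k + 1) t = delayB m δ k t := by
  induction k with
  | zero =>
    intro t ht
    exact opT_zero m hneg _ (by simpa using ht)
  | succ k ih =>
    intro t ht
    refine opT_congr m fun s hs => ih _ ?_
    push_cast at ht
    linarith

lemma exists_approx (m : Measure (ℝ × ℝ)) [IsFiniteMeasure m] (h0 : ∀ t, m {p | p.1 = t} = 0)
    (hneg : m {p | p.1 ≤ 0} = 0) (tf : ℝ) {ε : ℝ} (hε : 0 < ε) :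
    ∃ b : ℝ → ℝ, Measurable b ∧ ∀ s, 0 ≤ s → s ≤ tf → |opT m b s - b s| ≤ ε := by
  -- the time marginal distribution function
  have hFc : Continuous fun t => m.real {p : ℝ × ℝ | p.1 ≤ t} := by
    rw [continuous_iff_continuousAt]
    intro t
    have hm : ∀ i : ℝ, MeasurableSet {p : ℝ × ℝ | p.1 ≤ i} := fun i =>
      measurableSet_le measurable_fst measurable_const
    refine real_tendsto (nhds t) m (hm t) hm ?_
    have : ∀ᵐ p ∂m, p.1 ≠ t := by
      rw [ae_iff]; simpa using h0 t
    filter_upwards [this] with p hp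
    rcases lt_or_gt_of_ne hp with h | h
    · filter_upwards [lt_mem_nhds h] with i hi
      simp [hi.le, h.le]
    · filter_upwards [gt_mem_nhds h] with i hi
      simp [not_le.2 hi, not_le.2 h]
  have hu := (isCompact_Icc (a := (-1 : ℝ)) (b := tf)).uniformContinuousOn_of_continuous
    hFc.continuousOn
  rw [Metric.uniformContinuousOn_iff] at hu
  obtain ⟨η, hη, hu⟩ := hu ε hε
  set δ := min 1 (η / 2) with hδ
  have hδ0 : 0 < δ := lt_min one_pos (by linarith)
  have hδ1 : δ ≤ 1 := min_le_left _ _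
  have hδη : δ < η := (min_le_right _ _).trans_lt (by linarith)
  obtain ⟨N, hN⟩ := exists_nat_ge (tf / δ)
  rw [div_le_iff₀ hδ0] at hN
  have hmeas : Measurable (fun s => delayB m δ N (s - δ)) :=
    (delayB_mono m δ N).measurable.comp (measurable_id.sub_const δ)
  refine ⟨fun s => delayB m δ N (s - δ), hmeas, fun s hs0 hs => ?_⟩
  have e : delayB m δ N (s - δ) = opT m (fun s => delayB m δ N (s - δ)) (s - δ) :=
    (delayB_stable m hneg δ N (s - δ) (by linarith)).symm
  have hle : s - δ ≤ s := by linarith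
  simp only []
  rw [e, opT_diff m hmeas hle, abs_of_nonneg measureReal_nonneg]
  have h1 : m.real {p : ℝ × ℝ | s - δ < p.1 ∧ p.1 ≤ s ∧ delayB m δ N (p.1 - δ) ≤ p.2} ≤
      m.real ({p : ℝ × ℝ | p.1 ≤ s} \ {p : ℝ × ℝ | p.1 ≤ s - δ}) :=
    measureReal_mono (fun p hp => ⟨hp.2.1, not_le.2 hp.1⟩)
  refine h1.trans ?_
  have hsub : {p : ℝ × ℝ | p.1 ≤ s - δ} ⊆ {p : ℝ × ℝ | p.1 ≤ s} :=
    fun p hp => le_trans (show p.1 ≤ s - δ from hp) hle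
  rw [measureReal_sdiff hsub
    (measurableSet_le measurable_fst measurable_const)]
  have h2 := hu s ⟨by linarith, hs⟩ (s - δ) ⟨by linarith, by linarith⟩
    (by rw [Real.dist_eq]; simpa [abs_of_pos hδ0] using hδη)
  rw [Real.dist_eq] at h2
  exact (le_abs_self _).trans h2.le

lemma exists_fixed (m : Measure (ℝ × ℝ)) [IsFiniteMeasure m] (h0 : ∀ t, m {p | p.1 = t} = 0)
    (hneg : m {p | p.1 ≤ 0} = 0)
    (hgr : ∀ b : ℝ → ℝ, Measurable b → m {p | p.2 = b p.1} = 0) (tf : ℝ) :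
    ∃ b : ℝ → ℝ, Measurable b ∧ ∀ s, 0 ≤ s → s ≤ tf → opT m b s = b s := by
  have hpos : ∀ n : ℕ, (0:ℝ) < 1 / ((n:ℝ) + 1) := fun n => Nat.one_div_pos_of_nat
  choose b hbm hb using fun n : ℕ => exists_approx m h0 hneg tf (hpos n)
  have hlim0 := tendsto_one_div_add_atTop_nhds_zero_nat (𝕜 := ℝ)
  have hanti : ∀ {N n : ℕ}, N ≤ n → 1 / ((n:ℝ) + 1) ≤ 1 / ((N:ℝ) + 1) :=
    fun h => Nat.one_div_le_one_div h
  have hcau : ∀ t, 0 ≤ t → t ≤ tf → CauchySeq (fun n => opT m (b n) t) := by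
    intro t ht httf
    refine cauchySeq_of_le_tendsto_0 (fun N : ℕ => 2 * (1 / ((N:ℝ) + 1))) ?_
      (by simpa using hlim0.const_mul 2)
    intro n k N hn hk
    have hbn := fun s h1 h2 => (hb n s h1 h2).trans (hanti hn)
    have hbk := fun s h1 h2 => (hb k s h1 h2).trans (hanti hk)
    have c1 := compare m h0 hneg (hbm n) (hbm k) (hpos N).le hbn hbk ht httf
    have c2 := compare m h0 hneg (hbm k) (hbm n) (hpos N).le hbk hbn ht httf
    rw [Real.dist_eq, abs_le]
    constructor <;> linarith
  have hex : ∀ t, ∃ l, Tendsto (fun n => (Icc 0 tf).indicator (b n) t) atTop (nhds l) ∧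
      (0 ≤ t → t ≤ tf → Tendsto (fun n => opT m (b n) t) atTop (nhds l)) := by
    intro t
    by_cases h : t ∈ Icc 0 tf
    · obtain ⟨l, hl⟩ := cauchySeq_tendsto_of_complete (hcau t h.1 h.2)
      refine ⟨l, ?_, fun _ _ => hl⟩
      simp only [indicator_of_mem h]
      have hd : Tendsto (fun n => opT m (b n) t - b n t) atTop (nhds 0) :=
        squeeze_zero_norm (fun n => hb n t h.1 h.2) hlim0
      simpa using hl.sub hd
    · refine ⟨0, ?_, fun h1 h2 => absurd ⟨h1, h2⟩ h⟩
      simp [indicator_of_notMem h]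
  choose β hβ1 hβ2 using hex
  have hβm : Measurable β :=
    measurable_of_tendsto_metrizable (fun n => (hbm n).indicator measurableSet_Icc)
      (tendsto_pi_nhds.2 hβ1)
  refine ⟨β, hβm, fun t ht httf => ?_⟩
  refine tendsto_nhds_unique ?_ (hβ2 t ht httf)
  refine real_tendsto atTop m (meas_aux hβm t) (fun n => meas_aux (hbm n) t) ?_
  have hae : ∀ᵐ p ∂m, p.2 ≠ β p.1 := by
    rw [ae_iff]; simpa using hgr β hβm
  have hae2 : ∀ᵐ p ∂m, ¬ p.1 ≤ 0 := by
    rw [ae_iff]; simpa using hneg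
  filter_upwards [hae, hae2] with p hp hp2
  by_cases hpt : p.1 ≤ t
  · have hmem : p.1 ∈ Icc 0 tf := ⟨(not_le.1 hp2).le, hpt.trans httf⟩
    have hl := hβ1 p.1
    simp only [indicator_of_mem hmem] at hl
    rcases lt_or_gt_of_ne hp with h | h
    · filter_upwards [hl.eventually (lt_mem_nhds h)] with n hn
      simp [not_le.2 hn, not_le.2 h]
    · filter_upwards [hl.eventually (gt_mem_nhds h)] with n hn
      simp [hpt, hn.le, h.le]
  · simp [hpt]

lemma fixed_le_one (m : Measure (ℝ × ℝ)) [IsFiniteMeasure m] (h0 : ∀ t, m {p | p.1 = t} = 0)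
    (hneg : m {p | p.1 ≤ 0} = 0) (hone : m {p | 1 < p.2} = 0) {b : ℝ → ℝ} (hb : Measurable b)
    {tf : ℝ} (hfix : ∀ s, 0 ≤ s → s ≤ tf → opT m b s = b s) {t : ℝ} (ht : 0 ≤ t)
    (httf : t ≤ tf) : opT m b t ≤ 1 := by
  by_contra hcon
  rw [not_le] at hcon
  obtain ⟨s, hs0, hst, hs, hr⟩ := crossing (opT_cont m h0 hb) ht
    (by simp [opT_zero m hneg]) hcon
  have key : opT m b t - opT m b s = 0 := by
    rw [opT_diff m hb hst, measureReal_def, measure_mono_null _ hone, ENNReal.toReal_zero]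
    rintro p ⟨h1, h2, h3⟩
    have := hr p.1 h1 h2
    rw [hfix p.1 (hs0.trans h1.le) (h2.trans httf)] at this
    exact this.trans_le h3
  linarith

/-- The planar measure associated with `ν`. -/
def planar (d : ℕ) (tf : ℝ) (W : Set (Fin d → ℝ)) (ν : Measure (SpacePt d)) :
    Measure (ℝ × ℝ) :=
  (ν.restrict {p : SpacePt d | p.1 ∈ Icc (0:ℝ) tf ∧ p.2.1 ∈ Icc (0:ℝ) 1 ∧ p.2.2 ∈ W}).map
    (fun p => (p.1, p.2.1))

lemma bMass_eq (d : ℕ) (tf : ℝ) (W : Set (Fin d → ℝ)) (hW : MeasurableSet W)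
    (ν : Measure (SpacePt d)) [IsFiniteMeasure ν]
    (β : Icc (0:ℝ) tf → ℝ) (b : ℝ → ℝ) (hb : Measurable b) (hβ : ∀ s, β s = b s) (t : ℝ) :
    bMass d tf ν β t W = ENNReal.ofReal (opT (planar d tf W ν) b t) := by
  have hf : Measurable (fun p : SpacePt d => (p.1, p.2.1)) := by fun_prop
  have hV : MeasurableSet
      {p : SpacePt d | p.1 ∈ Icc (0:ℝ) tf ∧ p.2.1 ∈ Icc (0:ℝ) 1 ∧ p.2.2 ∈ W} :=
    (measurable_fst measurableSet_Icc).inter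
      (((measurable_fst.comp measurable_snd) measurableSet_Icc).inter
        ((measurable_snd.comp measurable_snd) hW))
  have : IsFiniteMeasure (planar d tf W ν) := by unfold planar; infer_instance
  unfold opT
  rw [ofReal_measureReal, planar, Measure.map_apply hf (meas_aux hb t),
    Measure.restrict_apply (hf (meas_aux hb t)), bMass]
  congr 1
  ext p
  simp only [mem_ofPred_eq, mem_inter_iff, mem_preimage, hβ]
  constructor
  · rintro ⟨h, h1, h2, h3, h4⟩
    exact ⟨⟨h1, h2⟩, h, h3, h4⟩
  · rintro ⟨⟨h1, h2⟩, h, h3, h4⟩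
    exact ⟨h, h1, h2, h3, h4⟩

lemma planar_ac (d : ℕ) (tf : ℝ) (W : Set (Fin d → ℝ))
    (μt : Measure ℝ) [IsFiniteMeasure μt] (hμt_ac : μt ≪ (volume : Measure ℝ))
    (μs : Measure (Fin d → ℝ)) [IsFiniteMeasure μs]
    (ν : Measure (SpacePt d)) (hν : ν ≪ muT d μt μs) :
    planar d tf W ν ≪ (volume : Measure ℝ).prod (volume : Measure ℝ) := by
  have hf : Measurable (fun p : SpacePt d => (p.1, p.2.1)) := by fun_prop
  have h1 : planar d tf W ν ≪ (muT d μt μs).map (fun p => (p.1, p.2.1)) :=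
    ((Measure.absolutelyContinuous_of_le Measure.restrict_le_self).trans hν).map hf
  refine h1.trans ?_
  have h2 : (muT d μt μs).map (fun p : SpacePt d => (p.1, p.2.1)) =
      (μt.map id).prod (((volume.restrict (Icc (0:ℝ) 1)).prod μs).map Prod.fst) := by
    rw [Measure.map_prod_map _ _ measurable_id measurable_fst]
    rfl
  rw [h2, Measure.map_id, Measure.map_fst_prod]
  refine hμt_ac.prod ?_
  exact (Measure.smul_absolutelyContinuous).trans
    (Measure.absolutelyContinuous_of_le Measure.restrict_le_self)

/-- For every finite Borel measure `ν ≪ μ_T` on `V` there is exactly one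
`β ∈ 𝓛` with `β_t = ν {(s,u,x) ∈ V : s ≤ t, β_s ≤ u}` for all `t ∈ [0,t_f]`, i.e. `β` is the
unique fixed point of the operator `𝒯_ν`. -/
theorem statement0
    (tf : ℝ) (htf : 0 < tf) (d : ℕ) (W : Set (Fin d → ℝ)) (hW : IsCompact W)
    (μt : Measure ℝ) [IsFiniteMeasure μt] (hμt_ac : μt ≪ (volume : Measure ℝ))
    (hμt_supp : μt (Icc (0:ℝ) tf)ᶜ = 0)
    (μs : Measure (Fin d → ℝ)) [IsFiniteMeasure μs]
    (hμs_ac : μs ≪ (volume : Measure (Fin d → ℝ))) (hμs_supp : μs Wᶜ = 0)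
    (ν : Measure (SpacePt d)) [IsFiniteMeasure ν] (hν : ν ≪ muT d μt μs) :
    ∃! β : Icc (0:ℝ) tf → ℝ, memL tf β ∧ IsFixedPt d tf W ν β := by
  set m := planar d tf W ν with hm
  have hWm := hW.measurableSet
  have hf : Measurable (fun p : SpacePt d => (p.1, p.2.1)) := by fun_prop
  have hfin : IsFiniteMeasure m := by rw [hm]; unfold planar; infer_instance
  have hac := planar_ac d tf W μt hμt_ac μs ν hν
  rw [← hm] at hac
  have hV : MeasurableSet
      {p : SpacePt d | p.1 ∈ Icc (0:ℝ) tf ∧ p.2.1 ∈ Icc (0:ℝ) 1 ∧ p.2.2 ∈ W} :=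
    (measurable_fst measurableSet_Icc).inter
      (((measurable_fst.comp measurable_snd) measurableSet_Icc).inter
        ((measurable_snd.comp measurable_snd) hWm))
  have h0 : ∀ t, m {p | p.1 = t} = 0 := by
    intro t
    apply hac
    have : {p : ℝ × ℝ | p.1 = t} = {t} ×ˢ univ := by ext p; simp
    rw [this, Measure.prod_prod]
    simp
  have hgr : ∀ b : ℝ → ℝ, Measurable b → m {p | p.2 = b p.1} = 0 := by
    intro b hb
    apply hac
    have hms : MeasurableSet {p : ℝ × ℝ | p.2 = b p.1} :=
      measurableSet_eq_fun measurable_snd (hb.comp measurable_fst)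
    rw [Measure.measure_prod_null hms]
    refine Eventually.of_forall fun x => ?_
    have : Prod.mk x ⁻¹' {p : ℝ × ℝ | p.2 = b p.1} = {b x} := by ext p; simp
    change volume (Prod.mk x ⁻¹' {p : ℝ × ℝ | p.2 = b p.1}) = 0
    rw [this]
    simp
  have hVm : ∀ A : Set (ℝ × ℝ), MeasurableSet A →
      (∀ p ∈ A, ¬ (p.1 ∈ Icc (0:ℝ) tf ∧ p.2 ∈ Icc (0:ℝ) 1)) → m A = 0 := by
    intro A hA hd
    rw [hm, planar, Measure.map_apply hf hA, Measure.restrict_apply (hf hA)]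
    convert measure_empty (μ := ν)
    ext p
    simp only [mem_inter_iff, mem_preimage, mem_ofPred_eq, mem_empty_iff_false, iff_false]
    rintro ⟨h1, h2, h3, h4⟩
    exact hd _ h1 ⟨h2, h3⟩
  have hneg : m {p | p.1 ≤ 0} = 0 := by
    have h1 : m {p | p.1 < 0} = 0 :=
      hVm _ (measurableSet_lt measurable_fst measurable_const)
        (fun p hp h => absurd h.1.1 (not_le.2 hp))
    refine measure_mono_null (t := {p | p.1 < 0} ∪ {p | p.1 = 0}) ?_
      (measure_union_null h1 (h0 0))
    intro p hp
    exact lt_or_eq_of_le (show p.1 ≤ 0 from hp)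
  have hone : m {p | 1 < p.2} = 0 :=
    hVm _ (measurableSet_lt measurable_const measurable_snd)
      (fun p hp h => absurd h.2.2 (not_le.2 hp))
  obtain ⟨b, hbm, hb⟩ := exists_fixed m h0 hneg hgr tf
  refine ⟨fun s => b s, ⟨⟨?_, ?_, ?_⟩, ?_⟩, ?_⟩
  · intro s t hst
    simp only
    rw [← hb s s.2.1 s.2.2, ← hb t t.2.1 t.2.2]
    exact opT_mono m b hst
  · intro s hs
    simp only
    rw [← hb s s.2.1 s.2.2]
    exact opT_zero m hneg b hs.le
  · intro s
    simp only
    rw [← hb s s.2.1 s.2.2]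
    exact ⟨measureReal_nonneg, fixed_le_one m h0 hneg hone hbm hb s.2.1 s.2.2⟩
  · intro t
    rw [bMass_eq d tf W hWm ν _ b hbm (fun _ => rfl), ← hm, hb t t.2.1 t.2.2]
  · rintro γ ⟨⟨hγm, hγ0, hγ1⟩, hγ⟩
    have hgm : Measurable (IccExtend htf.le γ) := (hγm.IccExtend htf.le).measurable
    have hge : ∀ s : Icc (0:ℝ) tf, γ s = IccExtend htf.le γ s := fun s =>
      (IccExtend_val htf.le γ s).symm
    have hg : ∀ s, 0 ≤ s → s ≤ tf → opT m (IccExtend htf.le γ) s = IccExtend htf.le γ s := by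
      intro s hs hs'
      have hmem : s ∈ Icc (0:ℝ) tf := ⟨hs, hs'⟩
      have h1 := hγ ⟨s, hmem⟩
      have hnn : 0 ≤ opT m (IccExtend htf.le γ) s := measureReal_nonneg
      rw [bMass_eq d tf W hWm ν γ _ hgm hge, ← hm,
        ENNReal.ofReal_eq_ofReal_iff (hγ1 _).1 hnn] at h1
      rw [← h1]
      exact hge ⟨s, hmem⟩
    ext t
    have a1 : ∀ s, 0 ≤ s → s ≤ tf → |opT m b s - b s| ≤ 0 :=
      fun s h1 h2 => by simp [hb s h1 h2]
    have a2 : ∀ s, 0 ≤ s → s ≤ tf →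
        |opT m (IccExtend htf.le γ) s - IccExtend htf.le γ s| ≤ 0 :=
      fun s h1 h2 => by rw [hg s h1 h2, sub_self, abs_zero]
    have c1 := compare m h0 hneg hbm hgm le_rfl a1 a2 t.2.1 t.2.2
    have c2 := compare m h0 hneg hgm hbm le_rfl a2 a1 t.2.1 t.2.2
    rw [hb t t.2.1 t.2.2, hg t t.2.1 t.2.2, ← hge] at c1 c2
    exact le_antisymm (by linarith) (by linarith)

end
end

section
/- Let ν be a finite Borel measure on V with ν ≪ μ_T. Then for every t ∈ [0,t_f], the evaluation map β ↦ 𝒯_ν(β)_t = ν({(s,u,x) ∈ V : s ≤ t and β_s ≤ u}) is continuous on 𝓛 when 𝓛 is equipped with the topology of pointwise convergence (the product topology inherited from [0,1]^{[0,t_f]}). Consequently 𝒯_ν is continuous as a map from 𝓛 with the product topology into [0,∞)^{[0,t_f]} with the product topology. -/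
open MeasureTheory Set Filter
open scoped ENNReal NNReal

noncomputable section

/-- For `ν ≪ μ_T` finite, each evaluation `β ↦ 𝒯_ν(β)_t` is continuous on `𝓛`
with the topology of pointwise convergence, and consequently `𝒯_ν : 𝓛 → [0,∞)^{[0,t_f]}` is
continuous for the product topologies. -/
theorem statement1
    (tf : ℝ) (htf : 0 < tf) (d : ℕ) (W : Set (Fin d → ℝ)) (hW : IsCompact W)
    (μt : Measure ℝ) [IsFiniteMeasure μt] (hμt_ac : μt ≪ (volume : Measure ℝ))
    (hμt_supp : μt (Icc (0:ℝ) tf)ᶜ = 0)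
    (μs : Measure (Fin d → ℝ)) [IsFiniteMeasure μs]
    (hμs_ac : μs ≪ (volume : Measure (Fin d → ℝ))) (hμs_supp : μs Wᶜ = 0)
    (ν : Measure (SpacePt d)) [IsFiniteMeasure ν] (hν : ν ≪ muT d μt μs) :
    (∀ t : Icc (0:ℝ) tf,
      Continuous fun β : {f : Icc (0:ℝ) tf → ℝ // memL tf f} =>
        (bMass d tf ν β.val (t : ℝ) W).toReal) ∧
    Continuous fun β : {f : Icc (0:ℝ) tf → ℝ // memL tf f} =>
      (fun t : Icc (0:ℝ) tf => (bMass d tf ν β.val (t : ℝ) W).toReal) := by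
  have main : ∀ t : Icc (0:ℝ) tf,
      Continuous fun β : {f : Icc (0:ℝ) tf → ℝ // memL tf f} =>
        (bMass d tf ν β.val (t : ℝ) W).toReal := by
    intro t
    rw [continuous_iff_continuousAt]
    intro β₀
    have hmono : ∀ β : {f : Icc (0:ℝ) tf → ℝ // memL tf f},
        Monotone (IccExtend htf.le β.val) := fun β => β.2.1.IccExtend htf.le
    have hset : ∀ β : {f : Icc (0:ℝ) tf → ℝ // memL tf f},
        {p : SpacePt d | ∃ h : p.1 ∈ Icc (0:ℝ) tf,
          p.1 ≤ t ∧ β.val ⟨p.1, h⟩ ≤ p.2.1 ∧ p.2.1 ∈ Icc (0:ℝ) 1 ∧ p.2.2 ∈ W}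
        = {p : SpacePt d | p.1 ∈ Icc (0:ℝ) tf ∧ p.1 ≤ t ∧
            IccExtend htf.le β.val p.1 ≤ p.2.1 ∧ p.2.1 ∈ Icc (0:ℝ) 1 ∧ p.2.2 ∈ W} := by
      intro β
      ext p
      constructor
      · rintro ⟨h, h1, h2, h3⟩
        refine ⟨h, h1, ?_, h3⟩
        rwa [IccExtend_of_mem htf.le _ h]
      · rintro ⟨h, h1, h2, h3⟩
        refine ⟨h, h1, ?_, h3⟩
        rwa [IccExtend_of_mem htf.le _ h] at h2
    have hmeas : ∀ β : {f : Icc (0:ℝ) tf → ℝ // memL tf f},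
        MeasurableSet {p : SpacePt d | p.1 ∈ Icc (0:ℝ) tf ∧ p.1 ≤ t ∧
            IccExtend htf.le β.val p.1 ≤ p.2.1 ∧ p.2.1 ∈ Icc (0:ℝ) 1 ∧ p.2.2 ∈ W} := by
      intro β
      have hb := (hmono β).measurable
      refine (measurable_fst measurableSet_Icc).inter
        ((measurableSet_le measurable_fst measurable_const).inter
        ((measurableSet_le (hb.comp measurable_fst) (measurable_fst.comp measurable_snd)).inter
        (((measurable_fst.comp measurable_snd) measurableSet_Icc).inter
        ((measurable_snd.comp measurable_snd) hW.measurableSet))))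
    let R : {f : Icc (0:ℝ) tf → ℝ // memL tf f} → (ℚ → ℝ) :=
      fun β q => IccExtend htf.le β.val (q : ℝ)
    have hR : Continuous R := by
      refine continuous_pi fun q => ?_
      exact (continuous_apply (projIcc 0 tf htf.le (q:ℝ))).comp continuous_subtype_val
    have hle : nhds β₀ ≤ comap R (nhds (R β₀)) := (hR.tendsto β₀).le_comap
    have hev : ∀ q : ℚ, Tendsto (fun β : {f : Icc (0:ℝ) tf → ℝ // memL tf f} =>
        IccExtend htf.le β.val (q : ℝ)) (comap R (nhds (R β₀)))
        (nhds (IccExtend htf.le β₀.val (q : ℝ))) := fun q =>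
      ((continuous_apply q).tendsto (R β₀)).comp tendsto_comap
    have hC := (hmono β₀).countable_not_continuousAt
    have hn1 : ∀ᵐ p ∂ν, ContinuousAt (IccExtend htf.le β₀.val) p.1 := by
      apply hν.ae_le
      have h0 : ∀ᵐ s ∂μt, ContinuousAt (IccExtend htf.le β₀.val) s :=
        hμt_ac.ae_le (hC.measure_zero volume)
      exact Measure.quasiMeasurePreserving_fst.ae h0
    have hn2 : ∀ᵐ p ∂ν, IccExtend htf.le β₀.val p.1 ≠ p.2.1 := by
      apply hν.ae_le
      have hm : MeasurableSet {p : SpacePt d | IccExtend htf.le β₀.val p.1 = p.2.1} :=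
        measurableSet_eq_fun ((hmono β₀).measurable.comp measurable_fst)
          (measurable_fst.comp measurable_snd)
      have h0 : muT d μt μs {p : SpacePt d | IccExtend htf.le β₀.val p.1 = p.2.1} = 0 := by
        unfold muT
        rw [Measure.measure_prod_null hm]
        refine Eventually.of_forall fun s => ?_
        have h1 : ∀ᵐ u ∂(volume.restrict (Icc (0:ℝ) 1)), u ≠ IccExtend htf.le β₀.val s :=
          Measure.ae_ne _ _
        have h2 : ∀ᵐ q ∂((volume.restrict (Icc (0:ℝ) 1)).prod μs),
            q.1 ≠ IccExtend htf.le β₀.val s := Measure.quasiMeasurePreserving_fst.ae h1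
        have h3 : ∀ᵐ q ∂((volume.restrict (Icc (0:ℝ) 1)).prod μs),
            ¬ (IccExtend htf.le β₀.val s = q.1) := h2.mono fun q hq h => hq h.symm
        simpa [ae_iff] using h3
      exact measure_eq_zero_iff_ae_notMem.1 h0
    have key : Tendsto (fun β : {f : Icc (0:ℝ) tf → ℝ // memL tf f} =>
        ν {p : SpacePt d | p.1 ∈ Icc (0:ℝ) tf ∧ p.1 ≤ t ∧
            IccExtend htf.le β.val p.1 ≤ p.2.1 ∧ p.2.1 ∈ Icc (0:ℝ) 1 ∧ p.2.2 ∈ W})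
        (comap R (nhds (R β₀)))
        (nhds (ν {p : SpacePt d | p.1 ∈ Icc (0:ℝ) tf ∧ p.1 ≤ t ∧
            IccExtend htf.le β₀.val p.1 ≤ p.2.1 ∧ p.2.1 ∈ Icc (0:ℝ) 1 ∧ p.2.2 ∈ W})) := by
      refine tendsto_measure_of_ae_tendsto_indicator_of_isFiniteMeasure _ (hmeas β₀) hmeas ?_
      filter_upwards [hn1, hn2] with p hp1 hp2
      rcases lt_or_gt_of_ne hp2 with hlt | hgt
      · have h1 := hp1.eventually (gt_mem_nhds hlt)
        obtain ⟨e, he, h2⟩ := Metric.eventually_nhds_iff.1 h1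
        obtain ⟨q, hq1, hq2⟩ := exists_rat_btwn (show p.1 < p.1 + e by linarith)
        have h3 : IccExtend htf.le β₀.val (q:ℝ) < p.2.1 := by
          apply h2
          rw [Real.dist_eq, abs_lt]
          constructor <;> linarith
        filter_upwards [(hev q).eventually (gt_mem_nhds h3)] with β hβ
        have h4 : IccExtend htf.le β.val p.1 ≤ p.2.1 := (hmono β hq1.le).trans hβ.le
        simp [h4, hlt.le]
      · have h1 := hp1.eventually (lt_mem_nhds hgt)
        obtain ⟨e, he, h2⟩ := Metric.eventually_nhds_iff.1 h1
        obtain ⟨q, hq1, hq2⟩ := exists_rat_btwn (show p.1 - e < p.1 by linarith)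
        have h3 : p.2.1 < IccExtend htf.le β₀.val (q:ℝ) := by
          apply h2
          rw [Real.dist_eq, abs_lt]
          constructor <;> linarith
        filter_upwards [(hev q).eventually (lt_mem_nhds h3)] with β hβ
        have h4 : ¬ IccExtend htf.le β.val p.1 ≤ p.2.1 :=
          not_le.2 (lt_of_lt_of_le hβ (hmono β hq2.le))
        have h5 : ¬ IccExtend htf.le β₀.val p.1 ≤ p.2.1 := not_le.2 hgt
        simp [h4, h5]
    have key2 := (ENNReal.tendsto_toReal (measure_ne_top ν _)).comp (key.mono_left hle)
    unfold ContinuousAt bMass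
    simp only [hset]
    exact key2
  exact ⟨main, continuous_pi main⟩

end
end

section
/- Let δ > 0 with t_f/δ ∈ ℕ and let ν be a finite Borel measure on V with ν ≪ μ_T. Then the two-step Picard approximation is dominated by the true solution: for every t ∈ [0,t_f], b^δ_t(ν)(W) ≤ β_t(ν)(W) = β̄(ν)_t. -/
open MeasureTheory Set Filter
open scoped ENNReal NNReal

noncomputable section

/-- `ν((nδ, (n+1)δ] × [0,1] × W)`. -/
noncomputable def slabMass (d : ℕ) (W : Set (Fin d → ℝ)) (ν : Measure (SpacePt d))
    (δ : ℝ) (n : ℕ) : ℝ≥0∞ :=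
  ν {p : SpacePt d | p.1 ∈ Ioc ((n : ℝ) * δ) (((n : ℝ) + 1) * δ) ∧
      p.2.1 ∈ Icc (0:ℝ) 1 ∧ p.2.2 ∈ W}

/-- Value `b^δ_{nδ}(ν)(A)` of the two-step Picard scheme at the grid time `nδ`. -/
noncomputable def bGrid (d : ℕ) (W : Set (Fin d → ℝ)) (ν : Measure (SpacePt d)) (δ : ℝ) :
    ℕ → Set (Fin d → ℝ) → ℝ
  | 0, _ => 0
  | n + 1, A =>
      bGrid d W ν δ n A +
        (ν {p : SpacePt d | p.1 ∈ Ioc ((n : ℝ) * δ) (((n : ℝ) + 1) * δ) ∧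
            p.2.1 ∈ Icc (bGrid d W ν δ n W + (slabMass d W ν δ n).toReal) 1 ∧
            p.2.2 ∈ A}).toReal

/-- `b^{↑,δ}_t(ν) = b^δ_{(n-1)δ}(ν)(W) + ν(((n-1)δ, nδ] × [0,1] × W)` for
`t ∈ ((n-1)δ, nδ]`. -/
noncomputable def bUp (d : ℕ) (W : Set (Fin d → ℝ)) (ν : Measure (SpacePt d)) (δ : ℝ)
    (t : ℝ) : ℝ :=
  bGrid d W ν δ (⌈t / δ⌉.toNat - 1) W + (slabMass d W ν δ (⌈t / δ⌉.toNat - 1)).toReal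

/-- `b^δ_t(ν)(A) = b^δ_{(n-1)δ}(ν)(A) + ν(((n-1)δ, t] × [b^{↑,δ}_{nδ}(ν), 1] × A)` for
`t ∈ ((n-1)δ, nδ]`. -/
noncomputable def bDel (d : ℕ) (W : Set (Fin d → ℝ)) (ν : Measure (SpacePt d)) (δ : ℝ)
    (t : ℝ) (A : Set (Fin d → ℝ)) : ℝ :=
  bGrid d W ν δ (⌈t / δ⌉.toNat - 1) A +
    (ν {p : SpacePt d | p.1 ∈ Ioc (((⌈t / δ⌉.toNat - 1 : ℕ) : ℝ) * δ) t ∧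
        p.2.1 ∈ Icc (bUp d W ν δ t) 1 ∧ p.2.2 ∈ A}).toReal

theorem bGrid_nonneg (d : ℕ) (W : Set (Fin d → ℝ)) (ν : Measure (SpacePt d)) (δ : ℝ)
    (n : ℕ) (A : Set (Fin d → ℝ)) : 0 ≤ bGrid d W ν δ n A := by
  induction n with
  | zero => simp [bGrid]
  | succ n ih =>
    rw [bGrid]
    exact add_nonneg ih ENNReal.toReal_nonneg

/-- One step of the comparison. -/
theorem step_le (tf : ℝ) (d : ℕ) (W : Set (Fin d → ℝ)) (hW : MeasurableSet W)
    (ν : Measure (SpacePt d)) [IsFiniteMeasure ν] (δ : ℝ)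
    (β : Icc (0:ℝ) tf → ℝ) (hβ : memL tf β) (hfix : IsFixedPt d tf W ν β)
    (n : ℕ) (r t : Icc (0:ℝ) tf) (hr : (r : ℝ) = n * δ) (hrt : r ≤ t)
    (ht : (t : ℝ) ≤ ((n : ℝ) + 1) * δ) (hb : bGrid d W ν δ n W ≤ β r) :
    bGrid d W ν δ n W + (ν {p : SpacePt d | p.1 ∈ Ioc ((n : ℝ) * δ) t ∧
        p.2.1 ∈ Icc (bGrid d W ν δ n W + (slabMass d W ν δ n).toReal) 1 ∧
        p.2.2 ∈ W}).toReal ≤ β t := by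
  have h0 := bGrid_nonneg d W ν δ n W
  have hs0 : 0 ≤ (slabMass d W ν δ n).toReal := ENNReal.toReal_nonneg
  set c := bGrid d W ν δ n W + (slabMass d W ν δ n).toReal with hc
  set B : Set (SpacePt d) := {p : SpacePt d | p.1 ∈ Ioc ((n : ℝ) * δ) t ∧
        p.2.1 ∈ Icc c 1 ∧ p.2.2 ∈ W} with hB
  have hBm : MeasurableSet B := by
    have : B = Ioc ((n : ℝ) * δ) (t : ℝ) ×ˢ (Icc c 1 ×ˢ W) := by
      ext p; simp [hB, Set.mem_prod]
    rw [this]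
    exact measurableSet_Ioc.prod (measurableSet_Icc.prod hW)
  rcases le_or_gt (β t) c with hle | hgt
  · have key : bMass d tf ν β (r : ℝ) W + ν B ≤ bMass d tf ν β (t : ℝ) W := by
      unfold bMass
      rw [← measure_union _ hBm]
      · apply measure_mono
        rintro p (⟨h, h1, h2⟩ | ⟨h1, h2, h3⟩)
        · exact ⟨h, h1.trans hrt, h2⟩
        · have hp : p.1 ∈ Icc (0:ℝ) tf :=
            ⟨by rw [← hr] at h1; exact r.2.1.trans h1.1.le, h1.2.trans t.2.2⟩
          refine ⟨hp, h1.2, ?_, ⟨by linarith [h2.1], h2.2⟩, h3⟩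
          exact (hβ.1 (show (⟨p.1, hp⟩ : Icc (0:ℝ) tf) ≤ t from h1.2)).trans (hle.trans h2.1)
      · rw [Set.disjoint_left]
        rintro p ⟨h, h1, h2⟩ ⟨h3, h4⟩
        rw [hr] at h1
        exact absurd h1 (not_le.mpr h3.1)
    rw [← hfix r, ← hfix t] at key
    have k2 := ENNReal.toReal_mono ENNReal.ofReal_ne_top key
    rw [ENNReal.toReal_add ENNReal.ofReal_ne_top (measure_ne_top _ _),
      ENNReal.toReal_ofReal (hβ.2.2 r).1, ENNReal.toReal_ofReal (hβ.2.2 t).1] at k2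
    linarith
  · have : (ν B).toReal ≤ (slabMass d W ν δ n).toReal := by
      apply ENNReal.toReal_mono (measure_ne_top _ _)
      apply measure_mono
      rintro p ⟨h1, h2, h3⟩
      exact ⟨⟨h1.1, h1.2.trans ht⟩, ⟨by linarith [h2.1], h2.2⟩, h3⟩
    linarith

/-- The two-step Picard approximation is dominated by the true solution:
`b^δ_t(ν)(W) ≤ β_t(ν)(W) = β̄(ν)_t` for all `t ∈ [0,t_f]`. -/
theorem statement2
    (tf : ℝ) (htf : 0 < tf) (d : ℕ) (W : Set (Fin d → ℝ)) (hW : IsCompact W)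
    (μt : Measure ℝ) [IsFiniteMeasure μt] (hμt_ac : μt ≪ (volume : Measure ℝ))
    (hμt_supp : μt (Icc (0:ℝ) tf)ᶜ = 0)
    (μs : Measure (Fin d → ℝ)) [IsFiniteMeasure μs]
    (hμs_ac : μs ≪ (volume : Measure (Fin d → ℝ))) (hμs_supp : μs Wᶜ = 0)
    (ν : Measure (SpacePt d)) [IsFiniteMeasure ν] (hν : ν ≪ muT d μt μs)
    (N : ℕ) (hN : 0 < N) (δ : ℝ) (hδpos : 0 < δ) (hNδ : (N : ℝ) * δ = tf)
    (β : Icc (0:ℝ) tf → ℝ) (hβ : memL tf β) (hfix : IsFixedPt d tf W ν β) :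
    ∀ t : Icc (0:ℝ) tf, bDel d W ν δ (t : ℝ) W ≤ β t := by
  have hWm : MeasurableSet W := hW.isClosed.measurableSet
  have grid : ∀ n : ℕ, ∀ r : Icc (0:ℝ) tf, (r : ℝ) = n * δ → bGrid d W ν δ n W ≤ β r := by
    intro n
    induction n with
    | zero => intro r _; exact (hβ.2.2 r).1
    | succ n ih =>
      intro r hr
      push_cast at hr
      have hle : (n : ℝ) * δ ≤ r := by rw [hr]; nlinarith
      have hq : (n : ℝ) * δ ∈ Icc (0:ℝ) tf := ⟨by positivity, hle.trans r.2.2⟩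
      have := step_le tf d W hWm ν δ β hβ hfix n ⟨_, hq⟩ r rfl hle hr.le (ih ⟨_, hq⟩ rfl)
      rw [hr] at this
      rw [bGrid]
      exact this
  intro t
  unfold bDel bUp
  set n := ⌈(t : ℝ) / δ⌉.toNat - 1 with hn
  have ht0 : 0 ≤ (t : ℝ) / δ := div_nonneg t.2.1 hδpos.le
  have hceil : n = ⌈(t : ℝ) / δ⌉₊ - 1 := by rw [hn, Int.ceil_toNat]
  have h1 : (n : ℝ) * δ ≤ t := by
    rw [← le_div_iff₀ hδpos]
    rcases Nat.eq_zero_or_pos n with h | h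
    · rw [h]; simpa using ht0
    · exact (Nat.lt_ceil.mp (by omega)).le
  have h2 : (t : ℝ) ≤ ((n : ℝ) + 1) * δ := by
    rw [← div_le_iff₀ hδpos]
    have := Nat.ceil_le (a := (t : ℝ) / δ) (n := n + 1)
    have h3 := this.mp (by omega)
    exact_mod_cast h3
  have hq : (n : ℝ) * δ ∈ Icc (0:ℝ) tf := ⟨by positivity, h1.trans t.2.2⟩
  exact step_le tf d W hWm ν δ β hβ hfix n ⟨_, hq⟩ t rfl h1 h2 (grid n ⟨_, hq⟩ rfl)

end
end

section
/- Let δ > 0 with t_f/δ ∈ ℕ and let ν be a finite Borel measure on V with ν ≪ μ_T. Then sup_{t ∈ [0,t_f]} |b^δ_t(ν)(W) − β_t(ν)(W)| ≤ 2 · max_{1 ≤ i ≤ t_f/δ} ν(((i−1)δ, iδ] × [0,1] × W). -/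
open MeasureTheory Set Filter
open scoped ENNReal NNReal

noncomputable section

theorem bGrid_nonneg_aux (d : ℕ) (W : Set (Fin d → ℝ)) (ν : Measure (SpacePt d)) (δ : ℝ)
    (n : ℕ) : 0 ≤ bGrid d W ν δ n W := by
  induction n with
  | zero => simp [bGrid]
  | succ k ih => rw [bGrid]; positivity

/-- Increment of the fixed point. -/
theorem incr_aux (tf : ℝ) (d : ℕ) (W : Set (Fin d → ℝ)) (ν : Measure (SpacePt d))
    [IsFiniteMeasure ν] (β : Icc (0:ℝ) tf → ℝ) (hβ : memL tf β) (hfix : IsFixedPt d tf W ν β)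
    (a t : Icc (0:ℝ) tf) (hat : (a:ℝ) ≤ t) :
    β t = β a + (ν {p : SpacePt d | ∃ h : p.1 ∈ Icc (0:ℝ) tf, p.1 ∈ Ioc (a:ℝ) t ∧
      β ⟨p.1, h⟩ ≤ p.2.1 ∧ p.2.1 ∈ Icc (0:ℝ) 1 ∧ p.2.2 ∈ W}).toReal := by
  have key : ∀ s : Icc (0:ℝ) tf, β s = (bMass d tf ν β s W).toReal := fun s => by
    rw [← hfix s, ENNReal.toReal_ofReal (hβ.2.2 s).1]
  rw [key t, key a]
  unfold bMass
  have hm : MeasurableSet {p : SpacePt d | p.1 ≤ (a:ℝ)} :=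
    measurableSet_le measurable_fst measurable_const
  rw [← measure_inter_add_diff _ hm, ENNReal.toReal_add (measure_ne_top _ _) (measure_ne_top _ _)]
  congr 3
  · congr 1
    ext p
    simp only [mem_inter_iff, mem_setOf_eq]
    constructor
    · rintro ⟨⟨h, h1, h2⟩, h3⟩
      exact ⟨h, h3, h2⟩
    · rintro ⟨h, h1, h2⟩
      exact ⟨⟨h, h1.trans hat, h2⟩, h1⟩
  · ext p
    simp only [mem_diff, mem_setOf_eq, not_le, mem_Ioc]
    constructor
    · rintro ⟨⟨h, h1, h2⟩, h3⟩
      exact ⟨h, ⟨h3, h1⟩, h2⟩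
    · rintro ⟨h, h1, h2⟩
      exact ⟨⟨h, h1.2, h2⟩, h1.1⟩

/-- One step of the comparison. -/
theorem step_aux (tf : ℝ) (d : ℕ) (W : Set (Fin d → ℝ)) (ν : Measure (SpacePt d))
    [IsFiniteMeasure ν] (δ : ℝ) (hδ : 0 < δ)
    (β : Icc (0:ℝ) tf → ℝ) (hβ : memL tf β) (hfix : IsFixedPt d tf W ν β)
    (n : ℕ) (a t : Icc (0:ℝ) tf) (ha : (a:ℝ) = n * δ) (hat : (a:ℝ) ≤ t)
    (ht : (t:ℝ) ≤ ((n:ℝ) + 1) * δ) (M : ℝ) (hM : (slabMass d W ν δ n).toReal ≤ M)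
    (h1 : bGrid d W ν δ n W - β a ≤ M) (h2 : -(2 * M) ≤ bGrid d W ν δ n W - β a) :
    let b := bGrid d W ν δ n W + (ν {p : SpacePt d | p.1 ∈ Ioc ((n:ℝ) * δ) (t:ℝ) ∧
        p.2.1 ∈ Icc (bGrid d W ν δ n W + (slabMass d W ν δ n).toReal) 1 ∧ p.2.2 ∈ W}).toReal
    b - β t ≤ M ∧ -(2 * M) ≤ b - β t := by
  intro b
  have hB := bGrid_nonneg_aux d W ν δ n
  have hm0 : 0 ≤ (slabMass d W ν δ n).toReal := ENNReal.toReal_nonneg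
  have hG : ∀ s : Icc (0:ℝ) tf, (a:ℝ) ≤ s → (s:ℝ) ≤ ((n:ℝ) + 1) * δ →
      β s ≤ β a + (slabMass d W ν δ n).toReal := by
    intro s has hs
    rw [incr_aux tf d W ν β hβ hfix a s has]
    gcongr
    · exact measure_ne_top _ _
    · unfold slabMass
      apply measure_mono
      rintro p ⟨h, h1, h2, h3⟩
      exact ⟨⟨ha ▸ h1.1, h1.2.trans hs⟩, h3⟩
  have hGt := hG t hat ht
  have hinc := incr_aux tf d W ν β hβ hfix a t hat
  have hmono : β a ≤ β t := hβ.1 hat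
  set D := (ν {p : SpacePt d | p.1 ∈ Ioc ((n:ℝ) * δ) (t:ℝ) ∧
        p.2.1 ∈ Icc (bGrid d W ν δ n W + (slabMass d W ν δ n).toReal) 1 ∧ p.2.2 ∈ W}).toReal with hD
  have hD0 : 0 ≤ D := ENNReal.toReal_nonneg
  have hDm : D ≤ (slabMass d W ν δ n).toReal := by
    apply ENNReal.toReal_mono (measure_ne_top _ _)
    apply measure_mono
    rintro p ⟨h1, h2, h3⟩
    exact ⟨⟨h1.1, h1.2.trans ht⟩, ⟨by linarith [h2.1], h2.2⟩, h3⟩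
  have hb : b = bGrid d W ν δ n W + D := rfl
  constructor
  · rcases le_total (β a) (bGrid d W ν δ n W) with hc | hc
    · have : D ≤ β t - β a := by
        rw [hinc, add_sub_cancel_left]
        apply ENNReal.toReal_mono (measure_ne_top _ _)
        apply measure_mono
        rintro p ⟨h1, h2, h3⟩
        have hp : p.1 ∈ Icc (0:ℝ) tf := ⟨by
          have := h1.1; have := a.2.1; linarith, h1.2.trans t.2.2⟩
        refine ⟨hp, ⟨ha ▸ h1.1, h1.2⟩, ?_, ⟨by linarith [h2.1], h2.2⟩, h3⟩
        have := hG ⟨p.1, hp⟩ (ha ▸ h1.1.le) (h1.2.trans ht)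
        linarith [h2.1]
      linarith
    · linarith
  · rcases le_total (bGrid d W ν δ n W + (slabMass d W ν δ n).toReal) (β a) with hc | hc
    · have : β t - β a ≤ D := by
        rw [hinc, add_sub_cancel_left]
        apply ENNReal.toReal_mono (measure_ne_top _ _)
        apply measure_mono
        rintro p ⟨h, h1, h2, h3, h4⟩
        have : β a ≤ β ⟨p.1, h⟩ := hβ.1 h1.1.le
        exact ⟨⟨ha ▸ h1.1, h1.2⟩, ⟨by linarith, h3.2⟩, h4⟩
      linarith
    · linarith

/-- `sup_t |b^δ_t(ν)(W) − β_t(ν)(W)| ≤ 2 · max_{1 ≤ i ≤ t_f/δ}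
ν(((i−1)δ, iδ] × [0,1] × W)`. -/
theorem statement3
    (tf : ℝ) (htf : 0 < tf) (d : ℕ) (W : Set (Fin d → ℝ)) (hW : IsCompact W)
    (μt : Measure ℝ) [IsFiniteMeasure μt] (hμt_ac : μt ≪ (volume : Measure ℝ))
    (hμt_supp : μt (Icc (0:ℝ) tf)ᶜ = 0)
    (μs : Measure (Fin d → ℝ)) [IsFiniteMeasure μs]
    (hμs_ac : μs ≪ (volume : Measure (Fin d → ℝ))) (hμs_supp : μs Wᶜ = 0)
    (ν : Measure (SpacePt d)) [IsFiniteMeasure ν] (hν : ν ≪ muT d μt μs)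
    (N : ℕ) (hN : 0 < N) (δ : ℝ) (hδpos : 0 < δ) (hNδ : (N : ℝ) * δ = tf)
    (β : Icc (0:ℝ) tf → ℝ) (hβ : memL tf β) (hfix : IsFixedPt d tf W ν β) :
    ∀ t : Icc (0:ℝ) tf,
      |bDel d W ν δ (t : ℝ) W - β t| ≤
        2 * (Finset.range N).sup' (Finset.nonempty_range_iff.mpr hN.ne')
          (fun i => (slabMass d W ν δ i).toReal) := by
  intro t
  set M := (Finset.range N).sup' (Finset.nonempty_range_iff.mpr hN.ne')
          (fun i => (slabMass d W ν δ i).toReal) with hMdef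
  have hM : ∀ n, n < N → (slabMass d W ν δ n).toReal ≤ M := fun n hn =>
    Finset.le_sup' (fun i => (slabMass d W ν δ i).toReal) (Finset.mem_range.mpr hn)
  have hM0 : 0 ≤ M := ENNReal.toReal_nonneg.trans (hM 0 hN)
  have hmem : ∀ n : ℕ, n ≤ N → (n:ℝ) * δ ∈ Icc (0:ℝ) tf := fun n hn =>
    ⟨by positivity, by rw [← hNδ]; gcongr⟩
  have grid : ∀ n : ℕ, ∀ hn : n ≤ N, bGrid d W ν δ n W - β ⟨n * δ, hmem n hn⟩ ≤ M ∧
      -(2 * M) ≤ bGrid d W ν δ n W - β ⟨n * δ, hmem n hn⟩ := by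
    intro n
    induction n with
    | zero =>
      intro hn
      rw [hβ.2.1 _ (by simp)]
      simp only [bGrid]
      constructor <;> linarith
    | succ k ih =>
      intro hn
      have hk : k ≤ N := by omega
      have := step_aux tf d W ν δ hδpos β hβ hfix k ⟨k * δ, hmem k hk⟩ ⟨_, hmem (k+1) hn⟩ rfl
        (by push_cast; nlinarith) (by push_cast; exact le_rfl) M (hM k (by omega)) (ih hk).1 (ih hk).2
      simp only [bGrid]
      push_cast at this ⊢
      exact this
  rcases eq_or_lt_of_le t.2.1 with h0 | h0
  · rw [hβ.2.1 t h0.symm]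
    unfold bDel
    rw [← h0]
    simp [bGrid]
    exact hM0
  · have hq : 0 < (t:ℝ) / δ := div_pos h0 hδpos
    have hc : 0 < ⌈(t:ℝ) / δ⌉ := Int.ceil_pos.mpr hq
    obtain ⟨n, hn⟩ : ∃ n : ℕ, ⌈(t:ℝ) / δ⌉ = (n:ℤ) + 1 :=
      ⟨(⌈(t:ℝ) / δ⌉ - 1).toNat, by omega⟩
    have hn' : ⌈(t:ℝ) / δ⌉.toNat - 1 = n := by omega
    obtain ⟨hlo, hhi⟩ := Int.ceil_eq_iff.mp hn
    push_cast at hlo hhi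
    have hlo' : (n:ℝ) * δ < t := by
      rw [lt_div_iff₀ hδpos] at hlo; linarith
    have hhi' : (t:ℝ) ≤ ((n:ℝ) + 1) * δ := by
      rwa [div_le_iff₀ hδpos] at hhi
    have hnN : n < N := by
      have : (n:ℝ) * δ < N * δ := by rw [hNδ]; exact hlo'.trans_le t.2.2
      exact_mod_cast lt_of_mul_lt_mul_right this hδpos.le
    have := step_aux tf d W ν δ hδpos β hβ hfix n ⟨n * δ, hmem n hnN.le⟩ t rfl
        hlo'.le hhi' M (hM n hnN) (grid n hnN.le).1 (grid n hnN.le).2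
    unfold bDel bUp
    rw [hn', abs_le]
    exact ⟨by linarith [this.2], by linarith [this.1]⟩

end
end

section
/- Let δ > 0 with t_f/δ ∈ ℕ and let ν be a finite Borel measure on V with ν ≪ μ_T. Writing I^δ_t(ν) for the closed interval with endpoints β_t(ν)(W) and b^{↑,δ}_t(ν), one has the uniform bound sup_{t ∈ [0,t_f]} sup_{A ⊆ W Borel} |b^δ_t(ν)(A) − β_t(ν)(A)| ≤ ν({(t,u,x) ∈ V : u ∈ I^δ_t(ν)}). -/
open MeasureTheory Set Filter
open scoped ENNReal NNReal

noncomputable section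

theorem idx_eq (δ : ℝ) (hδ : 0 < δ) (n : ℕ) (s : ℝ)
    (hs : s ∈ Ioc ((n : ℝ) * δ) (((n : ℝ) + 1) * δ)) : ⌈s / δ⌉.toNat - 1 = n := by
  have h : ⌈s / δ⌉ = (n : ℤ) + 1 := by
    rw [Int.ceil_eq_iff]
    push_cast
    constructor
    · rw [lt_div_iff₀ hδ]; linarith [hs.1]
    · rw [div_le_iff₀ hδ]; exact hs.2
  rw [h]; omega

theorem bUp_nonneg (d : ℕ) (W : Set (Fin d → ℝ)) (ν : Measure (SpacePt d)) (δ t : ℝ) :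
    0 ≤ bUp d W ν δ t := by
  have := bGrid_nonneg d W ν δ (⌈t / δ⌉.toNat - 1) W
  unfold bUp; positivity

theorem split_aux (d : ℕ) (W : Set (Fin d → ℝ)) (ν : Measure (SpacePt d)) [IsFiniteMeasure ν]
    (δ : ℝ) (hδ : 0 < δ) (n : ℕ) (A : Set (Fin d → ℝ)) (t : ℝ)
    (ht : t ∈ Ioc ((n : ℝ) * δ) (((n : ℝ) + 1) * δ)) :
    (ν {p : SpacePt d | p.1 ∈ Ioc 0 t ∧ p.2.1 ∈ Icc (bUp d W ν δ p.1) 1 ∧ p.2.2 ∈ A}).toReal =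
    (ν {p : SpacePt d | p.1 ∈ Ioc 0 ((n : ℝ) * δ) ∧ p.2.1 ∈ Icc (bUp d W ν δ p.1) 1 ∧
      p.2.2 ∈ A}).toReal +
    (ν {p : SpacePt d | p.1 ∈ Ioc ((n : ℝ) * δ) t ∧
      p.2.1 ∈ Icc (bGrid d W ν δ n W + (slabMass d W ν δ n).toReal) 1 ∧ p.2.2 ∈ A}).toReal := by
  have hm : MeasurableSet {p : SpacePt d | p.1 ≤ (n : ℝ) * δ} :=
    measurableSet_le measurable_fst measurable_const
  have hn : 0 ≤ (n : ℝ) * δ := by positivity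
  rw [← measure_inter_add_sdiff _ hm, ENNReal.toReal_add (measure_ne_top _ _) (measure_ne_top _ _)]
  congr 1
  · congr 2
    ext p
    simp only [mem_inter_iff, mem_ofPred_eq, mem_Ioc]
    constructor
    · rintro ⟨⟨⟨h1, h2⟩, h3⟩, h4⟩; exact ⟨⟨h1, h4⟩, h3⟩
    · rintro ⟨⟨h1, h2⟩, h3⟩; exact ⟨⟨⟨h1, h2.trans ht.1.le⟩, h3⟩, h2⟩
  · congr 2
    ext p
    simp only [Set.mem_sdiff, mem_ofPred_eq, not_le]
    have key : p.1 ∈ Ioc ((n : ℝ) * δ) t →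
        bUp d W ν δ p.1 = bGrid d W ν δ n W + (slabMass d W ν δ n).toReal := by
      intro h
      unfold bUp
      rw [idx_eq δ hδ n p.1 ⟨h.1, h.2.trans ht.2⟩]
    constructor
    · rintro ⟨⟨h1, h3⟩, h4⟩
      have h5 : p.1 ∈ Ioc ((n : ℝ) * δ) t := ⟨h4, h1.2⟩
      rw [key h5] at h3
      exact ⟨h5, h3⟩
    · rintro ⟨h1, h3⟩
      rw [← key h1] at h3
      exact ⟨⟨⟨hn.trans_lt h1.1, h1.2⟩, h3⟩, h1.1⟩

theorem bGrid_eq (d : ℕ) (W : Set (Fin d → ℝ)) (ν : Measure (SpacePt d)) [IsFiniteMeasure ν]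
    (δ : ℝ) (hδ : 0 < δ) (n : ℕ) (A : Set (Fin d → ℝ)) :
    bGrid d W ν δ n A = (ν {p : SpacePt d | p.1 ∈ Ioc 0 ((n : ℝ) * δ) ∧
      p.2.1 ∈ Icc (bUp d W ν δ p.1) 1 ∧ p.2.2 ∈ A}).toReal := by
  induction n with
  | zero => simp [bGrid]
  | succ n ih =>
    rw [bGrid, ih]
    push_cast
    rw [split_aux d W ν δ hδ n A (((n : ℝ) + 1) * δ) ⟨by nlinarith, le_rfl⟩]

theorem bDel_eq (d : ℕ) (W : Set (Fin d → ℝ)) (ν : Measure (SpacePt d)) [IsFiniteMeasure ν]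
    (δ : ℝ) (hδ : 0 < δ) (t : ℝ) (ht : 0 ≤ t) (A : Set (Fin d → ℝ)) :
    bDel d W ν δ t A = (ν {p : SpacePt d | p.1 ∈ Ioc 0 t ∧
      p.2.1 ∈ Icc (bUp d W ν δ p.1) 1 ∧ p.2.2 ∈ A}).toReal := by
  rcases ht.eq_or_lt with rfl | ht
  · simp [bDel, bGrid]
  · have hc : 0 < ⌈t / δ⌉ := Int.ceil_pos.2 (by positivity)
    obtain ⟨n, hn⟩ : ∃ n : ℕ, ⌈t / δ⌉ = (n : ℤ) + 1 := ⟨(⌈t / δ⌉ - 1).toNat, by omega⟩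
    have hmem : t ∈ Ioc ((n : ℝ) * δ) (((n : ℝ) + 1) * δ) := by
      rw [Int.ceil_eq_iff] at hn
      push_cast at hn
      rw [lt_div_iff₀ hδ, div_le_iff₀ hδ] at hn
      exact ⟨by linarith [hn.1], hn.2⟩
    have hi := idx_eq δ hδ n t hmem
    rw [split_aux d W ν δ hδ n A t hmem, ← bGrid_eq d W ν δ hδ]
    unfold bDel bUp
    rw [hi]

theorem null_zero (d : ℕ) (μt : Measure ℝ) [IsFiniteMeasure μt]
    (h : μt ≪ (volume : Measure ℝ)) (μs : Measure (Fin d → ℝ)) [IsFiniteMeasure μs]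
    (ν : Measure (SpacePt d)) (hν : ν ≪ muT d μt μs) : ν {p : SpacePt d | p.1 = 0} = 0 := by
  apply hν
  have : {p : SpacePt d | p.1 = 0} = ({0} : Set ℝ) ×ˢ univ := by ext p; simp
  rw [this, muT, Measure.prod_prod, h (by simp), zero_mul]

/-- Writing `I^δ_t(ν)` for the closed interval with endpoints `β_t(ν)(W)` and
`b^{↑,δ}_t(ν)`, one has `sup_t sup_A |b^δ_t(ν)(A) − β_t(ν)(A)| ≤ ν {(t,u,x) ∈ V : u ∈ I^δ_t(ν)}`. -/
theorem statement4
    (tf : ℝ) (htf : 0 < tf) (d : ℕ) (W : Set (Fin d → ℝ)) (hW : IsCompact W)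
    (μt : Measure ℝ) [IsFiniteMeasure μt] (hμt_ac : μt ≪ (volume : Measure ℝ))
    (hμt_supp : μt (Icc (0:ℝ) tf)ᶜ = 0)
    (μs : Measure (Fin d → ℝ)) [IsFiniteMeasure μs]
    (hμs_ac : μs ≪ (volume : Measure (Fin d → ℝ))) (hμs_supp : μs Wᶜ = 0)
    (ν : Measure (SpacePt d)) [IsFiniteMeasure ν] (hν : ν ≪ muT d μt μs)
    (N : ℕ) (hN : 0 < N) (δ : ℝ) (hδpos : 0 < δ) (hNδ : (N : ℝ) * δ = tf)
    (β : Icc (0:ℝ) tf → ℝ) (hβ : memL tf β) (hfix : IsFixedPt d tf W ν β) :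
    ∀ t : Icc (0:ℝ) tf, ∀ A : Set (Fin d → ℝ), MeasurableSet A → A ⊆ W →
      |bDel d W ν δ (t : ℝ) A - (bMass d tf ν β (t : ℝ) A).toReal| ≤
        (ν {p : SpacePt d | ∃ h : p.1 ∈ Icc (0:ℝ) tf,
            p.2.1 ∈ Icc (0:ℝ) 1 ∧ p.2.2 ∈ W ∧
            min (β ⟨p.1, h⟩) (bUp d W ν δ p.1) ≤ p.2.1 ∧
            p.2.1 ≤ max (β ⟨p.1, h⟩) (bUp d W ν δ p.1)}).toReal := by
  intro t A _ hAW
  rw [bDel_eq d W ν δ hδpos t t.2.1 A, bMass]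
  have h0 := null_zero d μt hμt_ac μs ν hν
  set E := {p : SpacePt d | p.1 ∈ Ioc 0 (t : ℝ) ∧
      p.2.1 ∈ Icc (bUp d W ν δ p.1) 1 ∧ p.2.2 ∈ A} with hE
  set F := {p : SpacePt d | ∃ h : p.1 ∈ Icc (0:ℝ) tf,
      p.1 ≤ t ∧ β ⟨p.1, h⟩ ≤ p.2.1 ∧ p.2.1 ∈ Icc (0:ℝ) 1 ∧ p.2.2 ∈ A} with hF
  set D := {p : SpacePt d | ∃ h : p.1 ∈ Icc (0:ℝ) tf,
            p.2.1 ∈ Icc (0:ℝ) 1 ∧ p.2.2 ∈ W ∧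
            min (β ⟨p.1, h⟩) (bUp d W ν δ p.1) ≤ p.2.1 ∧
            p.2.1 ≤ max (β ⟨p.1, h⟩) (bUp d W ν δ p.1)} with hD
  have h1 : E ⊆ F ∪ D := by
    rintro p ⟨hp, hu, hx⟩
    have hp' : p.1 ∈ Icc (0:ℝ) tf := ⟨hp.1.le, hp.2.trans t.2.2⟩
    have hu' : p.2.1 ∈ Icc (0:ℝ) 1 := ⟨(bUp_nonneg d W ν δ p.1).trans hu.1, hu.2⟩
    rcases le_total (β ⟨p.1, hp'⟩) p.2.1 with h | h
    · exact Or.inl ⟨hp', hp.2, h, hu', hx⟩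
    · exact Or.inr ⟨hp', hu', hAW hx, (min_le_right _ _).trans hu.1, h.trans (le_max_left _ _)⟩
  have h2 : F ⊆ (E ∪ D) ∪ {p : SpacePt d | p.1 = 0} := by
    rintro p ⟨hp, hpt, hb, hu, hx⟩
    rcases hp.1.eq_or_lt with h | hpos
    · exact Or.inr h.symm
    · left
      rcases le_total (bUp d W ν δ p.1) p.2.1 with h | h
      · exact Or.inl ⟨⟨hpos, hpt⟩, ⟨h, hu.2⟩, hx⟩
      · exact Or.inr ⟨hp, hu, hAW hx, (min_le_left _ _).trans hb, h.trans (le_max_right _ _)⟩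
  have k1 : (ν E).toReal ≤ (ν F).toReal + (ν D).toReal := by
    rw [← ENNReal.toReal_add (measure_ne_top _ _) (measure_ne_top _ _)]
    exact ENNReal.toReal_mono (by simp) ((measure_mono h1).trans (measure_union_le _ _))
  have k2 : (ν F).toReal ≤ (ν E).toReal + (ν D).toReal := by
    rw [← ENNReal.toReal_add (measure_ne_top _ _) (measure_ne_top _ _)]
    refine ENNReal.toReal_mono (by simp) ((measure_mono h2).trans ((measure_union_le _ _).trans ?_))
    rw [h0, add_zero]
    exact measure_union_le _ _
  rw [abs_le]
  constructor <;> linarith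

end
end

section
/- Setwise continuity of the discretized approximation: let t ∈ [0,t_f], δ > 0 with t_f/δ ∈ ℕ, A ⊆ W Borel, and let ν be a finite Borel measure on V with ν ≪ μ_T. If (ν_n) is a sequence of finite Borel measures on V converging to ν setwise (i.e., ν_n(E) → ν(E) for every Borel E ⊆ V), then γ^δ_t(ν_n)(A) → γ^δ_t(ν)(A), where γ^δ_t(ν)(A) = ν([0,t] × [0,1] × A) − b^δ_t(ν)(A); in particular b^δ_t(ν_n)(A) → b^δ_t(ν)(A). -/
open MeasureTheory Set Filter
open scoped ENNReal NNReal Topology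

noncomputable section

/-- The slab `S × [x,1] × A`. -/
def slabSet6 (d : ℕ) (S : Set ℝ) (A : Set (Fin d → ℝ)) (x : ℝ) : Set (SpacePt d) :=
  {p : SpacePt d | p.1 ∈ S ∧ p.2.1 ∈ Icc x 1 ∧ p.2.2 ∈ A}

theorem slabSet6_meas (d : ℕ) {S : Set ℝ} {A : Set (Fin d → ℝ)} (hS : MeasurableSet S)
    (hA : MeasurableSet A) (x : ℝ) : MeasurableSet (slabSet6 d S A x) :=
  (measurable_fst hS).inter (((measurable_fst.comp measurable_snd) measurableSet_Icc).inter
    ((measurable_snd.comp measurable_snd) hA))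

theorem slabSet6_anti (d : ℕ) (S : Set ℝ) (A : Set (Fin d → ℝ)) {x y : ℝ} (h : x ≤ y) :
    slabSet6 d S A y ⊆ slabSet6 d S A x :=
  fun _ hp => ⟨hp.1, ⟨h.trans hp.2.1.1, hp.2.1.2⟩, hp.2.2⟩

theorem null_level6 (d : ℕ) (μt : Measure ℝ) [IsFiniteMeasure μt]
    (μs : Measure (Fin d → ℝ)) [IsFiniteMeasure μs]
    (ν : Measure (SpacePt d)) (hν : ν ≪ muT d μt μs) (c : ℝ) :
    ∀ᵐ p ∂ν, p.2.1 ≠ c := by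
  have h : {p : SpacePt d | ¬ p.2.1 ≠ c} = univ ×ˢ (({c} : Set ℝ) ×ˢ univ) := by
    ext p; simp
  rw [ae_iff]
  apply hν
  change muT d μt μs {p : SpacePt d | ¬ p.2.1 ≠ c} = 0
  rw [h, muT, Measure.prod_prod, Measure.prod_prod]
  simp

theorem cont_level6 (d : ℕ) {S : Set ℝ} {A : Set (Fin d → ℝ)} (hS : MeasurableSet S)
    (hA : MeasurableSet A) (ν : Measure (SpacePt d)) [IsFiniteMeasure ν] (c : ℝ)
    (hc : ∀ᵐ p ∂ν, p.2.1 ≠ c) :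
    Tendsto (fun x => (ν (slabSet6 d S A x)).toReal) (𝓝 c)
      (𝓝 (ν (slabSet6 d S A c)).toReal) := by
  refine (ENNReal.tendsto_toReal (measure_ne_top _ _)).comp ?_
  refine tendsto_measure_of_ae_tendsto_indicator_of_isFiniteMeasure (𝓝 c)
    (slabSet6_meas d hS hA c) (fun x => slabSet6_meas d hS hA x) ?_
  filter_upwards [hc] with p hp
  rcases lt_or_gt_of_ne hp with h | h
  · filter_upwards [lt_mem_nhds h] with x hx
    simp [slabSet6, not_le.mpr h, not_le.mpr hx]
  · filter_upwards [gt_mem_nhds h] with x hx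
    simp [slabSet6, h.le, hx.le]

theorem key6 (d : ℕ) {S : Set ℝ} {A : Set (Fin d → ℝ)} (hS : MeasurableSet S)
    (hA : MeasurableSet A) (ν : Measure (SpacePt d)) [IsFiniteMeasure ν]
    (hc : ∀ c, ∀ᵐ p ∂ν, p.2.1 ≠ c)
    (νn : ℕ → Measure (SpacePt d)) (hfin : ∀ k, IsFiniteMeasure (νn k))
    (hsetwise : ∀ E : Set (SpacePt d), MeasurableSet E →
      Tendsto (fun k => ((νn k) E).toReal) atTop (𝓝 ((ν E).toReal)))
    (ck : ℕ → ℝ) (c : ℝ) (hck : Tendsto ck atTop (𝓝 c)) :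
    Tendsto (fun k => ((νn k) (slabSet6 d S A (ck k))).toReal) atTop
      (𝓝 (ν (slabSet6 d S A c)).toReal) := by
  have hcont := cont_level6 d hS hA ν c (hc c)
  rw [tendsto_order]
  constructor
  · intro a ha
    obtain ⟨x, hx1, hx2⟩ := (((hcont.mono_left nhdsWithin_le_nhds).eventually_const_lt ha).and
      (self_mem_nhdsWithin : Ioi c ∈ 𝓝[>] c)).exists
    filter_upwards [(hsetwise _ (slabSet6_meas d hS hA x)).eventually_const_lt hx1,
      hck.eventually_lt_const hx2] with k h1 h2
    have := hfin k
    exact h1.trans_le (ENNReal.toReal_mono (measure_ne_top _ _)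
      (measure_mono (slabSet6_anti d S A h2.le)))
  · intro a ha
    obtain ⟨x, hx1, hx2⟩ := (((hcont.mono_left nhdsWithin_le_nhds).eventually_lt_const ha).and
      (self_mem_nhdsWithin : Iio c ∈ 𝓝[<] c)).exists
    filter_upwards [(hsetwise _ (slabSet6_meas d hS hA x)).eventually_lt_const hx1,
      hck.eventually_const_lt hx2] with k h1 h2
    have := hfin k
    exact (ENNReal.toReal_mono (measure_ne_top _ _)
      (measure_mono (slabSet6_anti d S A h2.le))).trans_lt h1

theorem grid6 (d : ℕ) {W : Set (Fin d → ℝ)} (hW : MeasurableSet W) (δ : ℝ)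
    (ν : Measure (SpacePt d)) [IsFiniteMeasure ν]
    (hc : ∀ c, ∀ᵐ p ∂ν, p.2.1 ≠ c)
    (νn : ℕ → Measure (SpacePt d)) (hfin : ∀ k, IsFiniteMeasure (νn k))
    (hsetwise : ∀ E : Set (SpacePt d), MeasurableSet E →
      Tendsto (fun k => ((νn k) E).toReal) atTop (𝓝 ((ν E).toReal))) (n : ℕ) :
    ∀ A : Set (Fin d → ℝ), MeasurableSet A →
    Tendsto (fun k => bGrid d W (νn k) δ n A) atTop (𝓝 (bGrid d W ν δ n A)) := by
  induction n with
  | zero => intro A _; simp only [bGrid]; exact tendsto_const_nhds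
  | succ n ih =>
    intro A hA
    simp only [bGrid]
    exact (ih A hA).add (key6 d measurableSet_Ioc hA ν hc νn hfin hsetwise _ _
      ((ih W hW).add (hsetwise _ (slabSet6_meas d measurableSet_Ioc hW 0))))

/-- Setwise continuity of the discretized approximation: if finite measures
`ν_n → ν` setwise, then `γ^δ_t(ν_n)(A) → γ^δ_t(ν)(A)` where
`γ^δ_t(ν)(A) = ν([0,t] × [0,1] × A) − b^δ_t(ν)(A)`; in particular `b^δ_t(ν_n)(A) → b^δ_t(ν)(A)`. -/
theorem statement6
    (tf : ℝ) (htf : 0 < tf) (d : ℕ) (W : Set (Fin d → ℝ)) (hW : IsCompact W)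
    (μt : Measure ℝ) [IsFiniteMeasure μt] (hμt_ac : μt ≪ (volume : Measure ℝ))
    (hμt_supp : μt (Icc (0:ℝ) tf)ᶜ = 0)
    (μs : Measure (Fin d → ℝ)) [IsFiniteMeasure μs]
    (hμs_ac : μs ≪ (volume : Measure (Fin d → ℝ))) (hμs_supp : μs Wᶜ = 0)
    (ν : Measure (SpacePt d)) [IsFiniteMeasure ν] (hν : ν ≪ muT d μt μs)
    (N : ℕ) (hN : 0 < N) (δ : ℝ) (hδpos : 0 < δ) (hNδ : (N : ℝ) * δ = tf)
    (t : ℝ) (ht : t ∈ Icc (0:ℝ) tf)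
    (A : Set (Fin d → ℝ)) (hA : MeasurableSet A) (hAW : A ⊆ W)
    (νn : ℕ → Measure (SpacePt d)) (hfin : ∀ k, IsFiniteMeasure (νn k))
    (hsetwise : ∀ E : Set (SpacePt d), MeasurableSet E →
      Tendsto (fun k => ((νn k) E).toReal) atTop (𝓝 ((ν E).toReal))) :
    Tendsto (fun k =>
        ((νn k) {p : SpacePt d | p.1 ∈ Icc (0:ℝ) t ∧ p.2.1 ∈ Icc (0:ℝ) 1 ∧ p.2.2 ∈ A}).toReal
          - bDel d W (νn k) δ t A) atTop
      (𝓝 ((ν {p : SpacePt d | p.1 ∈ Icc (0:ℝ) t ∧ p.2.1 ∈ Icc (0:ℝ) 1 ∧ p.2.2 ∈ A}).toReal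
          - bDel d W ν δ t A)) ∧
    Tendsto (fun k => bDel d W (νn k) δ t A) atTop (𝓝 (bDel d W ν δ t A)) := by
  have hWm : MeasurableSet W := hW.isClosed.measurableSet
  have hc := null_level6 d μt μs ν hν
  have hg := grid6 d hWm δ ν hc νn hfin hsetwise (⌈t / δ⌉.toNat - 1)
  have hb : Tendsto (fun k => bDel d W (νn k) δ t A) atTop (𝓝 (bDel d W ν δ t A)) := by
    simp only [bDel]
    exact (hg A hA).add (key6 d measurableSet_Ioc hA ν hc νn hfin hsetwise _ _
      ((hg W hWm).add (hsetwise _ (slabSet6_meas d measurableSet_Ioc hWm 0))))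
  exact ⟨(hsetwise _ (slabSet6_meas d measurableSet_Icc hA 0)).sub hb, hb⟩

end
end

section
/- Total-variation Lipschitz bound for the scalar solution: let ν and ν' be finite Borel measures on V, each absolutely continuous with respect to μ_T, and let β̄(ν), β̄(ν') ∈ 𝓛 be the unique fixed points of 𝒯_ν and 𝒯_{ν'} respectively. Then sup_{t ∈ [0,t_f]} |β̄(ν)_t − β̄(ν')_t| ≤ sup_{E ⊆ V Borel} |ν(E) − ν'(E)|. -/
open MeasureTheory Set Filter
open scoped ENNReal NNReal

noncomputable section

/-- The extension of `β` to `ℝ`. -/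
def extB (tf : ℝ) (htf : 0 < tf) (β : Icc (0:ℝ) tf → ℝ) : ℝ → ℝ := IccExtend htf.le β

def setA (d : ℕ) (tf : ℝ) (W : Set (Fin d → ℝ)) (g : ℝ → ℝ) (t : ℝ) : Set (SpacePt d) :=
  {p | p.1 ∈ Icc (0:ℝ) tf ∧ p.1 ≤ t ∧ g p.1 ≤ p.2.1 ∧ p.2.1 ∈ Icc (0:ℝ) 1 ∧ p.2.2 ∈ W}

lemma bMass_eq_s7 (d : ℕ) (tf : ℝ) (htf : 0 < tf) (W : Set (Fin d → ℝ)) (ν : Measure (SpacePt d))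
    (β : Icc (0:ℝ) tf → ℝ) (t : ℝ) :
    bMass d tf ν β t W = ν (setA d tf W (extB tf htf β) t) := by
  unfold bMass setA extB
  congr 1
  ext p
  constructor
  · rintro ⟨h, h1, h2, h3, h4⟩
    refine ⟨h, h1, ?_, h3, h4⟩
    rw [IccExtend_of_mem htf.le β h]; exact h2
  · rintro ⟨h, h1, h2, h3, h4⟩
    refine ⟨h, h1, ?_, h3, h4⟩
    rw [IccExtend_of_mem htf.le β h] at h2; exact h2

lemma setA_meas (d : ℕ) (tf : ℝ) (W : Set (Fin d → ℝ)) (hW : MeasurableSet W) (g : ℝ → ℝ)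
    (hg : Measurable g) (t : ℝ) : MeasurableSet (setA d tf W g t) := by
  have h1 : MeasurableSet {p : SpacePt d | p.1 ∈ Icc (0:ℝ) tf} := measurable_fst measurableSet_Icc
  have h2 : MeasurableSet {p : SpacePt d | p.1 ≤ t} := measurable_fst measurableSet_Iic
  have h3 : MeasurableSet {p : SpacePt d | g p.1 ≤ p.2.1} :=
    measurableSet_le (hg.comp measurable_fst) (measurable_fst.comp measurable_snd)
  have h4 : MeasurableSet {p : SpacePt d | p.2.1 ∈ Icc (0:ℝ) 1} :=
    (measurable_fst.comp measurable_snd) measurableSet_Icc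
  have h5 : MeasurableSet {p : SpacePt d | p.2.2 ∈ W} :=
    (measurable_snd.comp measurable_snd) hW
  exact h1.inter (h2.inter (h3.inter (h4.inter h5)))

lemma setA_mono (d : ℕ) (tf : ℝ) (W : Set (Fin d → ℝ)) (g : ℝ → ℝ) : 
    Monotone (setA d tf W g) := by
  rintro s t hst p ⟨h1, h2, h3⟩
  exact ⟨h1, h2.trans hst, h3⟩

lemma slice_null (d : ℕ) (μt : Measure ℝ) [IsFiniteMeasure μt] (hμt_ac : μt ≪ (volume : Measure ℝ))
    (μs : Measure (Fin d → ℝ)) [IsFiniteMeasure μs]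
    (ν : Measure (SpacePt d)) (hν : ν ≪ muT d μt μs) (τ : ℝ) :
    ν {p | p.1 = τ} = 0 := by
  apply hν
  have : {p : SpacePt d | p.1 = τ} = ({τ} : Set ℝ) ×ˢ univ := by ext; simp
  rw [this, muT, Measure.prod_prod, hμt_ac (by simp), zero_mul]

lemma one_side
    (tf : ℝ) (htf : 0 < tf) (d : ℕ) (W : Set (Fin d → ℝ)) (hW : MeasurableSet W)
    (ν ν' : Measure (SpacePt d)) [IsFiniteMeasure ν] [IsFiniteMeasure ν']
    (hν : ∀ τ : ℝ, ν {p | p.1 = τ} = 0)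
    (β β' : Icc (0:ℝ) tf → ℝ) (hβ : memL tf β) (hβ' : memL tf β')
    (hfix : IsFixedPt d tf W ν β) (hfix' : IsFixedPt d tf W ν' β')
    (t : Icc (0:ℝ) tf) (C : ℝ)
    (hC : ∀ E : Set (SpacePt d), MeasurableSet E → (ν E).toReal - (ν' E).toReal ≤ C) :
    β t - β' t ≤ C := by
  set g := extB tf htf β with hg
  set g' := extB tf htf β' with hg'
  have gm : Monotone g := hβ.1.IccExtend _
  have gm' : Monotone g' := hβ'.1.IccExtend _
  have ge : ∀ s : Icc (0:ℝ) tf, g s = β s := fun s => IccExtend_val _ _ s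
  have ge' : ∀ s : Icc (0:ℝ) tf, g' s = β' s := fun s => IccExtend_val _ _ s
  have F : ∀ s ∈ Icc (0:ℝ) tf, ENNReal.ofReal (g s) = ν (setA d tf W g s) := by
    intro s hs
    have := hfix ⟨s, hs⟩
    rwa [bMass_eq_s7 d tf htf, ← ge] at this
  have F' : ∀ s ∈ Icc (0:ℝ) tf, ENNReal.ofReal (g' s) = ν' (setA d tf W g' s) := by
    intro s hs
    have := hfix' ⟨s, hs⟩
    rwa [bMass_eq_s7 d tf htf, ← ge'] at this
  have g0 : ∀ s ∈ Icc (0:ℝ) tf, 0 ≤ g s := fun s hs => by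
    rw [ge ⟨s, hs⟩]; exact (hβ.2.2 _).1
  have g0' : ∀ s ∈ Icc (0:ℝ) tf, 0 ≤ g' s := fun s hs => by
    rw [ge' ⟨s, hs⟩]; exact (hβ'.2.2 _).1
  obtain ⟨t, ht⟩ := t
  rw [← ge, ← ge']
  change g t - g' t ≤ C
  -- the last crossing time
  let S : Set ℝ := {s | s ∈ Icc 0 t ∧ g s ≤ g' s}
  have h00 : (0:ℝ) ∈ Icc (0:ℝ) tf := ⟨le_rfl, htf.le⟩
  have hS0 : (0:ℝ) ∈ S := by
    refine ⟨⟨le_rfl, ht.1⟩, ?_⟩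
    have e1 := ge ⟨0, h00⟩
    have e2 := ge' ⟨0, h00⟩
    rw [hβ.2.1 _ rfl] at e1
    rw [hβ'.2.1 _ rfl] at e2
    exact (e1.trans e2.symm).le
  have hSb : BddAbove S := ⟨t, fun s hs => hs.1.2⟩
  set τ := sSup S with hτ
  have hτ0 : 0 ≤ τ := le_csSup hSb hS0
  have hτt : τ ≤ t := csSup_le ⟨0, hS0⟩ fun s hs => hs.1.2
  have hτm : τ ∈ Icc (0:ℝ) tf := ⟨hτ0, hτt.trans ht.2⟩
  obtain ⟨u, um, ulim, uS⟩ := exists_seq_tendsto_sSup ⟨0, hS0⟩ hSb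
  have key : g τ ≤ g' τ := by
    rw [← ENNReal.ofReal_le_ofReal_iff (g0' τ hτm), F τ hτm]
    calc ν (setA d tf W g τ) ≤ ν ((⋃ n, setA d tf W g (u n)) ∪ {p | p.1 = τ}) := by
          apply measure_mono
          rintro p ⟨h1, h2, h3⟩
          rcases h2.lt_or_eq with h | h
          · left
            obtain ⟨n, hn⟩ := (ulim.eventually (lt_mem_nhds h)).exists
            exact mem_iUnion.2 ⟨n, h1, hn.le, h3⟩
          · right; exact h
      _ ≤ ν (⋃ n, setA d tf W g (u n)) + ν {p | p.1 = τ} := measure_union_le _ _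
      _ = ⨆ n, ν (setA d tf W g (u n)) := by
          rw [hν, add_zero]
          exact ((setA_mono d tf W g).comp um).measure_iUnion
      _ ≤ ENNReal.ofReal (g' τ) := by
          apply iSup_le
          intro n
          rw [← F (u n) ⟨(uS n).1.1, (uS n).1.2.trans ht.2⟩]
          exact ENNReal.ofReal_le_ofReal ((uS n).2.trans (gm' (le_csSup hSb (uS n))))
  have R : ∀ s ∈ Icc (0:ℝ) tf, g s = ν.real (setA d tf W g s) := fun s hs => by
    rw [Measure.real, ← F s hs, ENNReal.toReal_ofReal (g0 s hs)]
  have R' : ∀ s ∈ Icc (0:ℝ) tf, g' s = ν'.real (setA d tf W g' s) := fun s hs => by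
    rw [Measure.real, ← F' s hs, ENNReal.toReal_ofReal (g0' s hs)]
  have M := setA_meas d tf W hW g gm.measurable
  have M' := setA_meas d tf W hW g' gm'.measurable
  have D : g t - g τ = ν.real (setA d tf W g t \ setA d tf W g τ) := by
    rw [measureReal_sdiff (setA_mono d tf W g hτt) (M τ), R t ht, R τ hτm]
  have D' : g' t - g' τ = ν'.real (setA d tf W g' t \ setA d tf W g' τ) := by
    rw [measureReal_sdiff (setA_mono d tf W g' hτt) (M' τ), R' t ht, R' τ hτm]
  have I : ν'.real (setA d tf W g t \ setA d tf W g τ) ≤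
      ν'.real (setA d tf W g' t \ setA d tf W g' τ) := by
    refine measureReal_mono ?_ (measure_ne_top _ _)
    rintro p ⟨⟨h1, h2, h3, h4⟩, h5⟩
    have hlt : τ < p.1 := by
      by_contra hc
      exact h5 ⟨h1, not_lt.1 hc, h3, h4⟩
    refine ⟨⟨h1, h2, ?_, h4⟩, fun hc => absurd hc.2.1 (not_le.2 hlt)⟩
    by_contra hc
    have : p.1 ∈ S := ⟨⟨h1.1, h2⟩, by linarith⟩
    exact absurd (le_csSup hSb this) (not_le.2 hlt)
  have := hC _ ((M t).diff (M τ))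
  simp only [Measure.real] at *
  linarith

/-- Total-variation Lipschitz bound for the scalar solution:
`sup_t |β̄(ν)_t − β̄(ν')_t| ≤ sup_E |ν(E) − ν'(E)|`. -/
theorem statement7
    (tf : ℝ) (htf : 0 < tf) (d : ℕ) (W : Set (Fin d → ℝ)) (hW : IsCompact W)
    (μt : Measure ℝ) [IsFiniteMeasure μt] (hμt_ac : μt ≪ (volume : Measure ℝ))
    (hμt_supp : μt (Icc (0:ℝ) tf)ᶜ = 0)
    (μs : Measure (Fin d → ℝ)) [IsFiniteMeasure μs]
    (hμs_ac : μs ≪ (volume : Measure (Fin d → ℝ))) (hμs_supp : μs Wᶜ = 0)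
    (ν ν' : Measure (SpacePt d)) [IsFiniteMeasure ν] [IsFiniteMeasure ν']
    (hν : ν ≪ muT d μt μs) (hν' : ν' ≪ muT d μt μs)
    (β β' : Icc (0:ℝ) tf → ℝ) (hβ : memL tf β) (hβ' : memL tf β')
    (hfix : IsFixedPt d tf W ν β) (hfix' : IsFixedPt d tf W ν' β') :
    ∀ t : Icc (0:ℝ) tf, ∀ C : ℝ,
      (∀ E : Set (SpacePt d), MeasurableSet E → |(ν E).toReal - (ν' E).toReal| ≤ C) →
      |β t - β' t| ≤ C := by
  intro t C hC
  have n := slice_null d μt hμt_ac μs ν hν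
  have n' := slice_null d μt hμt_ac μs ν' hν'
  have hWm := hW.isClosed.measurableSet
  rw [abs_sub_le_iff]
  exact ⟨one_side tf htf d W hWm ν ν' n β β' hβ hβ' hfix hfix' t C
      fun E hE => (abs_sub_le_iff.1 (hC E hE)).1,
    one_side tf htf d W hWm ν' ν n' β' β hβ' hβ hfix' hfix t C
      fun E hE => (abs_sub_le_iff.1 (hC E hE)).2⟩

end
end

section
/- The frustration map is 2-Lipschitz in total variation: let A and B be finite sets of requests (triples (t,x,y) ∈ ℝ × X × Y) such that all time coordinates of points of A ∪ B are pairwise distinct. Then max(|F(A) \ F(B)|, |F(B) \ F(A)|) ≤ 2 · max(|A \ B|, |B \ A|). Equivalently, the associated counting measures of frustrated requests γ(A), γ(B) satisfy ‖γ(A) − γ(B)‖ ≤ 2‖1_A − 1_B‖, where ‖·‖ is the supremum over subsets of the absolute difference of counts. -/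
open MeasureTheory Set Filter
open scoped ENNReal NNReal Topology

noncomputable section

/-- A request is a triple `(t,x,y)` of time, location and chosen relay.  For a set `S` of
requests, `frus S` is the set of frustrated requests: those that are not the earliest request
of `S` to their relay. -/
def frus {X Y : Type*} (S : Set (ℝ × X × Y)) : Set (ℝ × X × Y) :=
  {z ∈ S | ∃ z' ∈ S, z'.2.2 = z.2.2 ∧ z'.1 < z.1}

theorem frus_aux {X Y : Type*} (A B : Set (ℝ × X × Y)) (hA : A.Finite)
    (hinj : Set.InjOn Prod.fst (A ∪ B)) :
    (frus A \ frus B).ncard ≤ 2 * (A \ B).ncard := by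
  have hfin : (A \ B).Finite := hA.subset Set.diff_subset
  have hsub : frus A \ frus B ⊆ (A \ B) ∪ ((frus A \ frus B) ∩ B) := by
    intro z hz
    by_cases hb : z ∈ B
    · exact Or.inr ⟨hz, hb⟩
    · exact Or.inl ⟨hz.1.1, hb⟩
  have hfin2 : ((frus A \ frus B) ∩ B).Finite := hA.subset (fun z hz => hz.1.1.1)
  have key : ∀ z ∈ (frus A \ frus B) ∩ B, ∃ z' ∈ A \ B, z'.2.2 = z.2.2 := by
    rintro z ⟨⟨⟨_, z', hz', hy, ht⟩, hn⟩, hb⟩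
    exact ⟨z', ⟨hz', fun h => hn ⟨hb, z', h, hy, ht⟩⟩, hy⟩
  choose! f hf hfy using key
  have h2 : ((frus A \ frus B) ∩ B).ncard ≤ (A \ B).ncard := by
    refine Set.ncard_le_ncard_of_injOn f hf ?_ hfin
    intro z hz w hw hzw
    have hy : z.2.2 = w.2.2 := by rw [← hfy z hz, ← hfy w hw, hzw]
    apply hinj (Or.inr hz.2) (Or.inr hw.2)
    apply le_antisymm
    · exact not_lt.mp fun h => hz.1.2 ⟨hz.2, w, hw.2, hy.symm, h⟩
    · exact not_lt.mp fun h => hw.1.2 ⟨hw.2, z, hz.2, hy, h⟩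
  have h3 := Set.ncard_le_ncard hsub (hfin.union hfin2)
  have h4 := Set.ncard_union_le (A \ B) ((frus A \ frus B) ∩ B)
  omega

/-- The frustration map is 2-Lipschitz in total variation:
`max(|F(A) \\ F(B)|, |F(B) \\ F(A)|) ≤ 2 · max(|A \\ B|, |B \\ A|)` for finite sets of
requests with pairwise distinct times. -/
theorem statement8 {X Y : Type*} (A B : Set (ℝ × X × Y)) (hA : A.Finite) (hB : B.Finite)
    (hinj : Set.InjOn Prod.fst (A ∪ B)) :
    max ((frus A \ frus B).ncard) ((frus B \ frus A).ncard) ≤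
      2 * max ((A \ B).ncard) ((B \ A).ncard) := by
  have h1 := frus_aux A B hA hinj
  have h2 := frus_aux B A hB (by rwa [Set.union_comm])
  omega

end
end

section
/- Uniform absolute continuity over entropy balls: let μ be a finite measure on a measurable space (S,𝒮) and let α > 0. Then for every η > 0 there exists ε > 0 such that for every measurable set A with μ(A) < ε and every finite measure ν on (S,𝒮) with h(ν|μ) ≤ α, one has ν(A) < η. Equivalently, lim_{ε↓0} sup{ ν(A) : A ∈ 𝒮 with μ(A) < ε, ν finite with h(ν|μ) ≤ α } = 0. -/
open MeasureTheory Set Filter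
open scoped ENNReal NNReal Topology

noncomputable section

/-- Relative entropy `h(ν|μ) = ∫ log(dν/dμ) dν − ν(S) + μ(S)` if `ν ≪ μ`, `∞` otherwise,
written as `∫ (r log r − r + 1) dμ` with `r = dν/dμ ≥ 0`, whose integrand is nonnegative. -/
noncomputable def relEnt {S : Type*} [MeasurableSpace S] (ν μ : Measure S) : ℝ≥0∞ :=
  letI := Classical.propDecidable (ν ≪ μ)
  if ν ≪ μ then
    ∫⁻ x, ENNReal.ofReal
      ((ν.rnDeriv μ x).toReal * Real.log (ν.rnDeriv μ x).toReal
        - (ν.rnDeriv μ x).toReal + 1) ∂μ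
  else ⊤

/-- Young's inequality for the entropy function. -/
theorem young_entropy (r c : ℝ) (hr : 0 ≤ r) :
    c * r ≤ (r * Real.log r - r + 1) + Real.exp c := by
  rcases hr.eq_or_lt with h | h
  · subst h
    simp
    positivity
  · have h1 := Real.add_one_le_exp (c - Real.log r)
    rw [Real.exp_sub, Real.exp_log h, le_div_iff₀ h] at h1
    nlinarith

/-- Uniform absolute continuity over entropy balls: for every `η > 0` there
is `ε > 0` such that `μ(A) < ε` and `h(ν|μ) ≤ α` imply `ν(A) < η`. -/
theorem statement12 {S : Type*} [MeasurableSpace S] (μ : Measure S) [IsFiniteMeasure μ]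
    (α : ℝ) (hα : 0 < α) :
    ∀ η : ℝ, 0 < η → ∃ ε : ℝ, 0 < ε ∧
      ∀ A : Set S, MeasurableSet A → μ A < ENNReal.ofReal ε →
        ∀ ν : Measure S, IsFiniteMeasure ν → relEnt ν μ ≤ ENNReal.ofReal α →
          ν A < ENNReal.ofReal η := by
  intro η hη
  have hc : 0 < 2 * α / η := by positivity
  obtain ⟨c, hcdef⟩ : ∃ c, c = 2 * α / η := ⟨_, rfl⟩
  rw [← hcdef] at hc
  have hcη : c * η = α + α := by rw [hcdef]; field_simp; ring
  refine ⟨α / Real.exp c, by positivity, ?_⟩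
  intro A hA hμA ν hν hent
  have hac : ν ≪ μ := by
    by_contra h
    simp [relEnt, h] at hent
  simp only [relEnt, hac, if_true] at hent
  have key : ENNReal.ofReal c * ν A ≤ ENNReal.ofReal α + ENNReal.ofReal (Real.exp c) * μ A := by
    calc ENNReal.ofReal c * ν A = ∫⁻ x in A, ENNReal.ofReal c * ν.rnDeriv μ x ∂μ := by
          rw [lintegral_const_mul _ (Measure.measurable_rnDeriv ν μ),
            Measure.setLIntegral_rnDeriv hac]
      _ ≤ ∫⁻ x in A, (ENNReal.ofReal ((ν.rnDeriv μ x).toReal * Real.log (ν.rnDeriv μ x).toReal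
            - (ν.rnDeriv μ x).toReal + 1) + ENNReal.ofReal (Real.exp c)) ∂μ := by
          apply lintegral_mono_ae
          filter_upwards [ae_restrict_of_ae (Measure.rnDeriv_lt_top ν μ)] with x hx
          have h1 := young_entropy (ν.rnDeriv μ x).toReal c ENNReal.toReal_nonneg
          calc ENNReal.ofReal c * ν.rnDeriv μ x
              = ENNReal.ofReal (c * (ν.rnDeriv μ x).toReal) := by
                rw [ENNReal.ofReal_mul hc.le, ENNReal.ofReal_toReal hx.ne]
            _ ≤ _ := (ENNReal.ofReal_le_ofReal h1).trans ENNReal.ofReal_add_le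
      _ ≤ _ := by
          rw [lintegral_add_right _ measurable_const, setLIntegral_const]
          gcongr
          exact (setLIntegral_le_lintegral _ _).trans hent
  have hlt : ENNReal.ofReal (Real.exp c) * μ A < ENNReal.ofReal α := by
    have h2 : ENNReal.ofReal α
        = ENNReal.ofReal (Real.exp c) * ENNReal.ofReal (α / Real.exp c) := by
      rw [← ENNReal.ofReal_mul (Real.exp_pos c).le]
      congr 1
      field_simp
    rw [h2]
    exact ENNReal.mul_lt_mul_right (by simpa using Real.exp_pos c) ENNReal.ofReal_ne_top hμA
  by_contra hge
  rw [not_lt] at hge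
  have h3 : ENNReal.ofReal α + ENNReal.ofReal α ≤ ENNReal.ofReal c * ν A := by
    rw [← ENNReal.ofReal_add hα.le hα.le, ← hcη, ENNReal.ofReal_mul hc.le]
    gcongr
  exact absurd (h3.trans key) (not_le.2 (ENNReal.add_lt_add_left ENNReal.ofReal_ne_top hlt))

end
end

section
/- Legendre duality for the Poissonian log-Laplace functional: let μ be a finite measure on a measurable space (S,𝒮) and let φ : S → ℝ be bounded and measurable. Then ∫_S (e^{φ} − 1) dμ = sup { ∫_S φ dν − h(ν|μ) : ν a finite measure on (S,𝒮) with h(ν|μ) < ∞ }, and the supremum is attained by the measure ν_φ with dν_φ/dμ = e^{φ}. -/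
open MeasureTheory Set Filter
open scoped ENNReal NNReal Topology

noncomputable section

open InformationTheory in
theorem relEnt_ac {S : Type*} [MeasurableSpace S] (ν μ : Measure S) (h : ν ≪ μ) :
    relEnt ν μ = ∫⁻ x, ENNReal.ofReal (klFun (ν.rnDeriv μ x).toReal) ∂μ := by
  unfold relEnt
  rw [if_pos h]
  refine lintegral_congr fun x => ?_
  congr 1
  rw [klFun_apply]; ring

open InformationTheory in
theorem relEnt_fin {S : Type*} [MeasurableSpace S] (ν μ : Measure S) (h : ν ≪ μ) :
    (relEnt ν μ ≠ ⊤ ↔ Integrable (fun x => klFun (ν.rnDeriv μ x).toReal) μ) ∧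
    (relEnt ν μ).toReal = ∫ x, klFun (ν.rnDeriv μ x).toReal ∂μ := by
  have hm : Measurable (fun x => klFun (ν.rnDeriv μ x).toReal) :=
    measurable_klFun.comp (Measure.measurable_rnDeriv ν μ).ennreal_toReal
  have h0 : 0 ≤ᵐ[μ] fun x => klFun (ν.rnDeriv μ x).toReal :=
    Eventually.of_forall fun x => klFun_nonneg ENNReal.toReal_nonneg
  rw [relEnt_ac ν μ h]
  exact ⟨lintegral_ofReal_ne_top_iff_integrable hm.aestronglyMeasurable h0,
    (integral_eq_lintegral_of_nonneg_ae h0 hm.aestronglyMeasurable).symm⟩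

open InformationTheory in
theorem young_klFun (r t : ℝ) (hr : 0 ≤ r) : r * t ≤ klFun r + (Real.exp t - 1) := by
  rw [klFun_apply]
  rcases hr.eq_or_lt with rfl | hr
  · simp [Real.exp_nonneg]
  · have h1 := Real.add_one_le_exp (t - Real.log r)
    rw [Real.exp_sub, Real.exp_log hr, le_div_iff₀ hr] at h1
    linarith

/-- Legendre duality for the Poissonian log-Laplace functional:
`∫ (e^φ − 1) dμ = sup { ∫ φ dν − h(ν|μ) }`, the supremum being attained at
`ν_φ = e^φ · μ`. -/
theorem statement15 {S : Type*} [MeasurableSpace S] (μ : Measure S) [IsFiniteMeasure μ]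
    (φ : S → ℝ) (hφm : Measurable φ) (hφb : ∃ C : ℝ, ∀ x, |φ x| ≤ C) :
    IsGreatest
      {r : ℝ | ∃ ν : Measure S, IsFiniteMeasure ν ∧ relEnt ν μ ≠ ⊤ ∧
        r = (∫ x, φ x ∂ν) - (relEnt ν μ).toReal}
      (∫ x, (Real.exp (φ x) - 1) ∂μ) ∧
    relEnt (μ.withDensity fun x => ENNReal.ofReal (Real.exp (φ x))) μ ≠ ⊤ ∧
    (∫ x, φ x ∂(μ.withDensity fun x => ENNReal.ofReal (Real.exp (φ x)))) -
        (relEnt (μ.withDensity fun x => ENNReal.ofReal (Real.exp (φ x))) μ).toReal =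
      ∫ x, (Real.exp (φ x) - 1) ∂μ := by
  obtain ⟨C, hC⟩ := hφb
  have hexp : Integrable (fun x => Real.exp (φ x)) μ := by
    refine Integrable.of_bound (C := Real.exp C) hφm.exp.aestronglyMeasurable
      (Eventually.of_forall fun x => ?_)
    rw [Real.norm_eq_abs, abs_of_pos (Real.exp_pos _)]
    exact Real.exp_le_exp.2 ((le_abs_self _).trans (hC x))
  have hexp1 : Integrable (fun x => Real.exp (φ x) - 1) μ := hexp.sub (integrable_const 1)
  have hφe : Integrable (fun x => Real.exp (φ x) * φ x) μ :=
    hexp.mul_bdd (c := C) hφm.aestronglyMeasurable (Eventually.of_forall hC)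
  set ν := μ.withDensity fun x => ENNReal.ofReal (Real.exp (φ x)) with hν
  have hfin : IsFiniteMeasure ν := isFiniteMeasure_withDensity_ofReal hexp.2
  have hac : ν ≪ μ := withDensity_absolutelyContinuous _ _
  have hrn : ν.rnDeriv μ =ᵐ[μ] fun x => ENNReal.ofReal (Real.exp (φ x)) :=
    Measure.rnDeriv_withDensity μ hφm.exp.ennreal_ofReal
  have hkl : (fun x => InformationTheory.klFun (ν.rnDeriv μ x).toReal) =ᵐ[μ]
      fun x => Real.exp (φ x) * φ x - (Real.exp (φ x) - 1) := by
    filter_upwards [hrn] with x hx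
    rw [hx, ENNReal.toReal_ofReal (Real.exp_nonneg _), InformationTheory.klFun_apply,
      Real.log_exp]
    ring
  obtain ⟨h1, h2⟩ := relEnt_fin ν μ hac
  have hne : relEnt ν μ ≠ ⊤ := h1.2 ((hφe.sub hexp1).congr hkl.symm)
  have hI : ∫ x, φ x ∂ν = ∫ x, Real.exp (φ x) * φ x ∂μ := by
    rw [← integral_rnDeriv_smul hac]
    refine integral_congr_ae ?_
    filter_upwards [hrn] with x hx
    rw [hx, ENNReal.toReal_ofReal (Real.exp_nonneg _), smul_eq_mul]
  have heq : (∫ x, φ x ∂ν) - (relEnt ν μ).toReal = ∫ x, (Real.exp (φ x) - 1) ∂μ := by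
    rw [h2, integral_congr_ae hkl, integral_sub hφe hexp1, hI]
    ring
  refine ⟨⟨⟨ν, hfin, hne, heq.symm⟩, ?_⟩, hne, heq⟩
  rintro r ⟨η, hη, hηt, rfl⟩
  have hηac : η ≪ μ := by
    by_contra hcon
    exact hηt (by unfold relEnt; rw [if_neg hcon])
  obtain ⟨g1, g2⟩ := relEnt_fin η μ hηac
  have hk := g1.1 hηt
  have hrφ : Integrable (fun x => (η.rnDeriv μ x).toReal * φ x) μ :=
    Measure.integrable_toReal_rnDeriv.mul_bdd (c := C) hφm.aestronglyMeasurable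
      (Eventually.of_forall hC)
  have hint : ∫ x, φ x ∂η = ∫ x, (η.rnDeriv μ x).toReal * φ x ∂μ :=
    (integral_rnDeriv_smul hηac).symm
  rw [g2, hint, sub_le_iff_le_add', ← integral_add hk hexp1]
  exact integral_mono hrφ (hk.add hexp1) fun x => young_klFun _ _ ENNReal.toReal_nonneg

end
end

section
/- Sequential compactness of entropy level sets in the setwise (τ-) topology: let μ be a finite measure on a measurable space (S,𝒮) and α ≥ 0. Then every sequence (ν_n) of finite measures on (S,𝒮) with h(ν_n|μ) ≤ α for all n admits a subsequence (ν_{n_k}) and a finite measure ν with h(ν|μ) ≤ α such that ∫ g dν_{n_k} → ∫ g dν for every bounded measurable g : S → ℝ (in particular ν_{n_k}(E) → ν(E) for every E ∈ 𝒮). -/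
open MeasureTheory Set Filter
open scoped ENNReal NNReal Topology

noncomputable section

lemma hilbert_subseq {H : Type*} [NormedAddCommGroup H] [InnerProductSpace ℝ H] [CompleteSpace H]
    (x : ℕ → ℕ → H) (C : ℕ → ℝ) (hx : ∀ j k, ‖x j k‖ ≤ C j) :
    ∃ φ : ℕ → ℕ, StrictMono φ ∧ ∀ j y, ∃ l, Tendsto (fun k => inner ℝ y (x j (φ k))) atTop (𝓝 l) := by
  have hC : ∀ j, 0 ≤ C j := fun j => (norm_nonneg _).trans (hx j 0)
  have hcomp : IsCompact (Set.pi univ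
      (fun p : ℕ × ℕ => Icc (-(C p.1 * C p.1)) (C p.1 * C p.1))) :=
    isCompact_univ_pi (fun p => isCompact_Icc)
  obtain ⟨a, -, φ, hφ, hlim⟩ := hcomp.tendsto_subseq
    (x := fun k (p : ℕ × ℕ) => inner ℝ (x p.1 p.2) (x p.1 k)) (by
      intro k p _
      have h1 := abs_real_inner_le_norm (x p.1 p.2) (x p.1 k)
      have h2 : ‖x p.1 p.2‖ * ‖x p.1 k‖ ≤ C p.1 * C p.1 :=
        mul_le_mul (hx _ _) (hx _ _) (norm_nonneg _) (hC _)
      exact abs_le.1 (h1.trans h2))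
  rw [tendsto_pi_nhds] at hlim
  refine ⟨φ, hφ, fun j => ?_⟩
  -- convergence on the span
  have hspan : ∀ y ∈ Submodule.span ℝ (range (x j)),
      ∃ l, Tendsto (fun k => inner ℝ y (x j (φ k))) atTop (𝓝 l) := by
    intro y hy
    induction hy using Submodule.span_induction with
    | mem y hy =>
      obtain ⟨m, rfl⟩ := hy
      exact ⟨_, hlim (j, m)⟩
    | zero => exact ⟨0, by simp⟩
    | add y z _ _ h1 h2 =>
      obtain ⟨l1, h1⟩ := h1
      obtain ⟨l2, h2⟩ := h2
      exact ⟨l1 + l2, by simpa [inner_add_left] using h1.add h2⟩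
    | smul c y _ h1 =>
      obtain ⟨l1, h1⟩ := h1
      exact ⟨c * l1, by simpa [real_inner_smul_left] using h1.const_mul c⟩
  set K := (Submodule.span ℝ (range (x j))).topologicalClosure with hK
  have hclos : ∀ y ∈ K, ∃ l, Tendsto (fun k => inner ℝ y (x j (φ k))) atTop (𝓝 l) := by
    intro y hy
    apply cauchySeq_tendsto_of_complete
    rw [Metric.cauchySeq_iff']
    intro ε hε
    have hy' : y ∈ closure ((Submodule.span ℝ (range (x j)) : Submodule ℝ H) : Set H) := hy
    have hpos : 0 < C j + 1 := by linarith [hC j]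
    obtain ⟨z, hz, hyz⟩ := Metric.mem_closure_iff.1 hy' (ε / (3 * (C j + 1))) (by positivity)
    obtain ⟨l, hl⟩ := hspan z hz
    obtain ⟨N, hN⟩ := Metric.cauchySeq_iff'.1 hl.cauchySeq (ε / 3) (by positivity)
    have key : ∀ k, |inner ℝ y (x j (φ k)) - inner ℝ z (x j (φ k))| ≤ ε / 3 := by
      intro k
      rw [← inner_sub_left]
      refine (abs_real_inner_le_norm _ _).trans ?_
      rw [dist_eq_norm] at hyz
      calc ‖y - z‖ * ‖x j (φ k)‖ ≤ (ε / (3 * (C j + 1))) * (C j + 1) :=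
            mul_le_mul hyz.le ((hx _ _).trans (by linarith)) (norm_nonneg _) (by positivity)
        _ = ε / 3 := by field_simp
    refine ⟨N, fun n hn => ?_⟩
    have h1 := key n
    have h2 := key N
    have h3 := hN n hn
    rw [Real.dist_eq] at h3 ⊢
    rw [abs_le] at h1 h2
    rw [abs_lt] at h3 ⊢
    constructor <;> linarith [h1.1, h1.2, h2.1, h2.2, h3.1, h3.2]
  intro y
  have : CompleteSpace K := (Submodule.isClosed_topologicalClosure _).completeSpace_coe
  obtain ⟨l, hl⟩ := hclos (K.starProjection y) (Submodule.starProjection_apply_mem _ _)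
  refine ⟨l, hl.congr fun k => ?_⟩
  have hxk : x j (φ k) ∈ K :=
    Submodule.le_topologicalClosure _ (Submodule.subset_span ⟨_, rfl⟩)
  have := Submodule.starProjection_inner_eq_zero (K := K) y _ hxk
  rw [inner_sub_left] at this
  linarith

lemma klFun_trunc (j : ℕ) (r : ℝ) (hr : 0 ≤ r) :
    ((j : ℝ) + 1) * (r - min r (Real.exp (j + 2))) ≤ InformationTheory.klFun r := by
  rcases le_total r (Real.exp (j + 2)) with h | h
  · rw [min_eq_left h]
    simpa using InformationTheory.klFun_nonneg hr
  · rw [min_eq_right h, InformationTheory.klFun_apply]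
    have hpos : 0 < r := (Real.exp_pos _).trans_le h
    have h1 : (j : ℝ) + 2 ≤ Real.log r := (Real.le_log_iff_exp_le hpos).2 h
    have h2 := Real.exp_pos ((j : ℝ) + 2)
    have h3 : (0 : ℝ) ≤ j := Nat.cast_nonneg j
    nlinarith [mul_le_mul_of_nonneg_left h1 hr, mul_nonneg h3 h2.le]

lemma relEnt_of_ac {S : Type*} [MeasurableSpace S] {ν μ : Measure S} (h : ν ≪ μ) :
    relEnt ν μ = ∫⁻ x, ENNReal.ofReal (InformationTheory.klFun (ν.rnDeriv μ x).toReal) ∂μ := by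
  unfold relEnt
  rw [if_pos h]
  refine lintegral_congr fun x => ?_
  rw [InformationTheory.klFun_apply]
  congr 1
  ring

lemma ac_of_relEnt {S : Type*} [MeasurableSpace S] {ν μ : Measure S} {α : ℝ}
    (h : relEnt ν μ ≤ ENNReal.ofReal α) : ν ≪ μ := by
  by_contra hc
  unfold relEnt at h
  rw [if_neg hc] at h
  exact ENNReal.ofReal_ne_top (top_le_iff.1 h)

lemma tail_bound {S : Type*} [MeasurableSpace S] {ν μ : Measure S} [IsFiniteMeasure μ]
    [IsFiniteMeasure ν] {α : ℝ} (hα : 0 ≤ α) (h : relEnt ν μ ≤ ENNReal.ofReal α) (j : ℕ)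
    {E : Set S} (hE : MeasurableSet E) :
    (∫ x in E, min (ν.rnDeriv μ x).toReal (Real.exp (j + 2)) ∂μ) ≤ ν.real E ∧
    ν.real E ≤ (∫ x in E, min (ν.rnDeriv μ x).toReal (Real.exp (j + 2)) ∂μ) + α / (j + 1) := by
  have hac := ac_of_relEnt h
  rw [relEnt_of_ac hac] at h
  have hint : Integrable (fun x => (ν.rnDeriv μ x).toReal) μ := Measure.integrable_toReal_rnDeriv
  have hmin : Integrable (fun x => min (ν.rnDeriv μ x).toReal (Real.exp (j + 2))) μ :=
    hint.inf (integrable_const _)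
  have hkm : Measurable (fun x => InformationTheory.klFun (ν.rnDeriv μ x).toReal) :=
    InformationTheory.measurable_klFun.comp (Measure.measurable_rnDeriv _ _).ennreal_toReal
  have hk0 : ∀ x, 0 ≤ InformationTheory.klFun (ν.rnDeriv μ x).toReal :=
    fun x => InformationTheory.klFun_nonneg ENNReal.toReal_nonneg
  have hki : Integrable (fun x => InformationTheory.klFun (ν.rnDeriv μ x).toReal) μ := by
    refine ⟨hkm.aestronglyMeasurable, ?_⟩
    rw [hasFiniteIntegral_iff_ofReal (ae_of_all _ hk0)]
    exact h.trans_lt ENNReal.ofReal_lt_top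
  have hkα : ∫ x, InformationTheory.klFun (ν.rnDeriv μ x).toReal ∂μ ≤ α := by
    rw [integral_eq_lintegral_of_nonneg_ae (ae_of_all _ hk0) hkm.aestronglyMeasurable]
    exact ENNReal.toReal_le_of_le_ofReal hα h
  rw [← Measure.setIntegral_toReal_rnDeriv hac E]
  have hj : (0 : ℝ) < (j : ℝ) + 1 := by positivity
  constructor
  · exact integral_mono hmin.integrableOn hint.integrableOn (fun x => min_le_left _ _)
  · rw [← sub_le_iff_le_add', ← integral_sub hint.integrableOn hmin.integrableOn,
      le_div_iff₀ hj, mul_comm, ← integral_const_mul]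
    calc _ ≤ ∫ x in E, InformationTheory.klFun (ν.rnDeriv μ x).toReal ∂μ :=
          integral_mono ((hint.sub hmin).const_mul _).integrableOn hki.integrableOn
            (fun x => klFun_trunc j _ ENNReal.toReal_nonneg)
      _ ≤ ∫ x, InformationTheory.klFun (ν.rnDeriv μ x).toReal ∂μ :=
          setIntegral_le_integral hki (ae_of_all _ hk0)
      _ ≤ α := hkα

lemma tail_bound' {S : Type*} [MeasurableSpace S] {ν μ : Measure S} [IsFiniteMeasure μ]
    [IsFiniteMeasure ν] {α : ℝ} (hα : 0 ≤ α) (h : relEnt ν μ ≤ ENNReal.ofReal α) (j : ℕ)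
    {E : Set S} (hE : MeasurableSet E) :
    ν E ≤ ENNReal.ofReal (Real.exp (j + 2)) * μ E + ENNReal.ofReal (α / (j + 1)) := by
  have h1 := (tail_bound hα h j hE).2
  have hint : Integrable (fun x => (ν.rnDeriv μ x).toReal) μ := Measure.integrable_toReal_rnDeriv
  have hmin : Integrable (fun x => min (ν.rnDeriv μ x).toReal (Real.exp (j + 2))) μ :=
    hint.inf (integrable_const _)
  have h2 : (∫ x in E, min (ν.rnDeriv μ x).toReal (Real.exp (j + 2)) ∂μ)
      ≤ Real.exp (j + 2) * μ.real E := by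
    calc _ ≤ ∫ x in E, Real.exp (j + 2) ∂μ :=
          integral_mono hmin.integrableOn (integrable_const _) (fun x => min_le_right _ _)
      _ = _ := by simp [mul_comm]
  have h3 : ν.real E ≤ Real.exp (j + 2) * μ.real E + α / (j + 1) := by linarith
  rw [← ofReal_measureReal (μ := ν) (s := E), ← ofReal_measureReal (μ := μ) (s := E),
    ← ENNReal.ofReal_mul (Real.exp_pos _).le, ← ENNReal.ofReal_add (by positivity) (by positivity)]
  exact ENNReal.ofReal_le_ofReal h3

/-- Setwise convergence along a subsequence. -/
lemma setwise_subseq {S : Type*} [MeasurableSpace S] (μ : Measure S) [IsFiniteMeasure μ]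
    (α : ℝ) (hα : 0 ≤ α) (ν : ℕ → Measure S) (hfin : ∀ k, IsFiniteMeasure (ν k))
    (hent : ∀ k, relEnt (ν k) μ ≤ ENNReal.ofReal α) :
    ∃ φ : ℕ → ℕ, StrictMono φ ∧ ∀ E, MeasurableSet E → 
      ∃ l, Tendsto (fun k => (ν (φ k)).real E) atTop (𝓝 l) := by
  have hmeas : ∀ k, Measurable (fun x => ((ν k).rnDeriv μ x).toReal) :=
    fun k => (Measure.measurable_rnDeriv _ _).ennreal_toReal
  have hbd : ∀ (j k : ℕ) (x : S), ‖min ((ν k).rnDeriv μ x).toReal (Real.exp (j + 2))‖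
      ≤ Real.exp (j + 2) := by
    intro j k x
    rw [Real.norm_of_nonneg (le_min ENNReal.toReal_nonneg (Real.exp_pos _).le)]
    exact min_le_right _ _
  have hLp : ∀ j k : ℕ, MemLp (fun x => min ((ν k).rnDeriv μ x).toReal (Real.exp (j + 2))) 2 μ :=
    fun j k => MemLp.of_bound ((hmeas k).min measurable_const).aestronglyMeasurable
      _ (ae_of_all _ (hbd j k))
  obtain ⟨φ, hφ, hlim⟩ := hilbert_subseq (H := Lp ℝ 2 μ) (fun j k => (hLp j k).toLp)
    (fun j => (μ.real univ) ^ ((2 : ℝ≥0∞).toReal)⁻¹ * Real.exp (j + 2)) (by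
      intro j k
      refine Lp.norm_le_of_ae_bound (Real.exp_pos _).le ?_
      filter_upwards [(hLp j k).coeFn_toLp] with x hx
      rw [hx]
      exact hbd j k x)
  refine ⟨φ, hφ, fun E hE => ?_⟩
  have hlim' : ∀ j : ℕ, ∃ l, Tendsto (fun k => 
      ∫ x in E, min ((ν (φ k)).rnDeriv μ x).toReal (Real.exp (j + 2)) ∂μ) atTop (𝓝 l) := by
    intro j
    obtain ⟨l, hl⟩ := hlim j (indicatorConstLp 2 hE (measure_ne_top μ E) (1 : ℝ))
    refine ⟨l, hl.congr fun k => ?_⟩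
    rw [L2.inner_indicatorConstLp_one]
    refine integral_congr_ae ?_
    exact ae_restrict_of_ae (hLp j (φ k)).coeFn_toLp
  apply cauchySeq_tendsto_of_complete
  rw [Metric.cauchySeq_iff']
  intro ε hε
  obtain ⟨j, hj⟩ := exists_nat_gt (3 * α / ε)
  have hjε : α / (j + 1) < ε / 3 := by
    rw [div_lt_iff₀ hε] at hj
    rw [div_lt_iff₀ (by positivity)]
    nlinarith
  obtain ⟨l, hl⟩ := hlim' j
  obtain ⟨N, hN⟩ := Metric.cauchySeq_iff'.1 hl.cauchySeq (ε / 3) (by positivity)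
  refine ⟨N, fun n hn => ?_⟩
  have h3 := hN n hn
  have h1 := tail_bound hα (hent (φ n)) j hE
  have h2 := tail_bound hα (hent (φ N)) j hE
  rw [Real.dist_eq, abs_lt] at h3 ⊢
  constructor <;> linarith [h1.1, h1.2, h2.1, h2.2, h3.1, h3.2]

/-- The setwise limit is a measure. -/
lemma setwise_limit {S : Type*} [MeasurableSpace S] (μ : Measure S) [IsFiniteMeasure μ]
    (α : ℝ) (hα : 0 ≤ α) (ν : ℕ → Measure S) (hfin : ∀ k, IsFiniteMeasure (ν k))
    (hent : ∀ k, relEnt (ν k) μ ≤ ENNReal.ofReal α) 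
    (hlim : ∀ E, MeasurableSet E → ∃ l, Tendsto (fun k => (ν k).real E) atTop (𝓝 l)) :
    ∃ νlim : Measure S, IsFiniteMeasure νlim ∧ νlim ≪ μ ∧
      ∀ E, MeasurableSet E → Tendsto (fun k => (ν k).real E) atTop (𝓝 (νlim.real E)) := by
  have hlim' : ∀ E, ∃ l : ℝ≥0∞, MeasurableSet E → Tendsto (fun k => ν k E) atTop (𝓝 l) := by
    intro E
    by_cases hE : MeasurableSet E
    · obtain ⟨l, hl⟩ := hlim E hE
      refine ⟨ENNReal.ofReal l, fun _ => ?_⟩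
      refine (ENNReal.tendsto_ofReal hl).congr fun k => ?_
      rw [ofReal_measureReal]
    · exact ⟨0, fun h => absurd h hE⟩
  choose m hm using hlim'
  have hbd : ∀ (j : ℕ) E, MeasurableSet E → 
      m E ≤ ENNReal.ofReal (Real.exp (j + 2)) * μ E + ENNReal.ofReal (α / (j + 1)) :=
    fun j E hE => le_of_tendsto (hm E hE)
      (Eventually.of_forall fun k => tail_bound' hα (hent k) j hE)
  have hε : Tendsto (fun j : ℕ => ENNReal.ofReal (α / (j + 1))) atTop (𝓝 0) := by
    have h : Tendsto (fun j : ℕ => α / ((j : ℝ) + 1)) atTop (𝓝 0) :=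
      tendsto_const_nhds.div_atTop (tendsto_atTop_add_const_right _ _ tendsto_natCast_atTop_atTop)
    simpa using ENNReal.tendsto_ofReal h
  have hne : ∀ E, MeasurableSet E → m E ≠ ∞ := fun E hE =>
    ne_top_of_le_ne_top (by finiteness) (hbd 0 E hE)
  let M : AddContent ℝ≥0∞ {s : Set S | MeasurableSet s} :=
    { toFun := m
      empty' := tendsto_nhds_unique (hm ∅ MeasurableSet.empty) (by simp)
      sUnion' := by
        intro I hI hd hU
        refine tendsto_nhds_unique (hm _ hU) ?_
        refine (tendsto_finsetSum I fun u hu => hm u (hI hu)).congr fun k => ?_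
        rw [Set.sUnion_eq_biUnion]
        exact (measure_biUnion_finset hd (fun b hb => hI hb)).symm }
  have hring : IsSetRing {s : Set S | MeasurableSet s} :=
    ⟨MeasurableSet.empty, fun _ _ h1 h2 => MeasurableSet.union h1 h2,
      fun _ _ h1 h2 => MeasurableSet.diff h1 h2⟩
  have hadd := addContent_iUnion_eq_sum_of_tendsto_zero hring M (fun s hs => hne s hs) (by
    intro s hs hanti hcap
    have hμ : Tendsto (fun n => μ (s n)) atTop (𝓝 0) := by
      have := tendsto_measure_iInter_atTop (μ := μ) (fun n => (hs n).nullMeasurableSet) hanti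
        ⟨0, measure_ne_top _ _⟩
      simpa [hcap, Function.comp_def] using this
    rw [ENNReal.tendsto_nhds_zero]
    intro ε hε0
    have hε2 : 0 < ε / 2 := ENNReal.half_pos hε0.ne'
    obtain ⟨j, hj⟩ := ((ENNReal.tendsto_nhds_zero.1 hε) (ε / 2) hε2).exists
    have h2 : Tendsto (fun n => ENNReal.ofReal (Real.exp (j + 2)) * μ (s n)) atTop (𝓝 0) := by
      simpa using ENNReal.Tendsto.const_mul hμ (Or.inr ENNReal.ofReal_ne_top)
    filter_upwards [(ENNReal.tendsto_nhds_zero.1 h2) (ε / 2) hε2] with n hn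
    calc m (s n) ≤ _ := hbd j _ (hs n)
      _ ≤ ε / 2 + ε / 2 := add_le_add hn hj
      _ = ε := ENNReal.add_halves ε)
  let νl : Measure S := Measure.ofMeasurable (fun s _ => m s) M.empty'
    (fun f hf hd => hadd hf (MeasurableSet.iUnion hf) hd)
  have hνl : ∀ E, MeasurableSet E → νl E = m E := fun E hE => Measure.ofMeasurable_apply E hE
  refine ⟨νl, ⟨?_⟩, ?_, ?_⟩
  · rw [hνl _ MeasurableSet.univ]
    exact (hne _ MeasurableSet.univ).lt_top
  · refine Measure.AbsolutelyContinuous.mk fun E hE h0 => ?_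
    rw [hνl E hE]
    refine le_antisymm (ge_of_tendsto' hε fun j => ?_) zero_le
    simpa [h0] using hbd j E hE
  · intro E hE
    rw [measureReal_def, hνl E hE]
    exact (ENNReal.tendsto_toReal (hne E hE)).comp (hm E hE)

/-- Setwise convergence of finite measures implies convergence on bounded measurable functions. -/
lemma bounded_conv {S : Type*} [MeasurableSpace S] (ν : ℕ → Measure S)
    (hfin : ∀ k, IsFiniteMeasure (ν k)) (νl : Measure S) [IsFiniteMeasure νl]
    (hlim : ∀ E, MeasurableSet E → Tendsto (fun k => (ν k).real E) atTop (𝓝 (νl.real E)))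
    (g : S → ℝ) (hg : Measurable g) (hb : ∃ C : ℝ, ∀ x, |g x| ≤ C) :
    Tendsto (fun k => ∫ x, g x ∂(ν k)) atTop (𝓝 (∫ x, g x ∂νl)) := by
  obtain ⟨C, hC⟩ := hb
  have hgi : ∀ (ρ : Measure S) [IsFiniteMeasure ρ], Integrable g ρ := fun ρ _ =>
    Integrable.of_bound hg.aestronglyMeasurable C (ae_of_all _ hC)
  have hrep : ∀ (ρ : Measure S) [IsFiniteMeasure ρ], ∫ x, g x ∂ρ =
      (∫ t in Ioc 0 (2 * C), ρ.real {a | t ≤ g a + C}) - C * ρ.real univ := by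
    intro ρ _
    have h := Integrable.integral_eq_integral_Ioc_meas_le (μ := ρ) (f := fun x => g x + C)
      (M := 2 * C) ((hgi ρ).add (integrable_const C))
      (ae_of_all _ fun x => by have := abs_le.1 (hC x); simp only [Pi.zero_apply]; linarith)
      (ae_of_all _ fun x => by have := abs_le.1 (hC x); show g x + C ≤ 2 * C; linarith)
    rw [← h, integral_add (hgi ρ) (integrable_const C)]
    simp [mul_comm]
  have hu := hlim univ MeasurableSet.univ
  obtain ⟨B, hB⟩ := hu.bddAbove_range
  rw [hrep νl]
  refine Tendsto.congr (fun k => (hrep (ν k)).symm) ?_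
  refine Tendsto.sub ?_ (hu.const_mul C)
  refine tendsto_integral_of_dominated_convergence (fun _ => B) ?_ (integrable_const _) ?_ ?_
  · intro k
    refine (Antitone.measurable fun s t hst => ?_).aestronglyMeasurable
    exact measureReal_mono (fun a ha => le_trans hst ha)
  · intro k
    refine ae_of_all _ fun t => ?_
    rw [Real.norm_of_nonneg measureReal_nonneg]
    exact (measureReal_mono (subset_univ _)).trans (hB ⟨k, rfl⟩)
  · refine ae_of_all _ fun t => hlim _ ?_
    exact measurableSet_le measurable_const (hg.add_const C)

lemma young (r t : ℝ) (hr : 0 ≤ r) : r * t ≤ InformationTheory.klFun r + (Real.exp t - 1) := by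
  rw [InformationTheory.klFun_apply]
  rcases hr.eq_or_lt with rfl | hr
  · simp [(Real.exp_pos t).le]
  · have h := Real.add_one_le_exp (t - Real.log r)
    rw [Real.exp_sub, Real.exp_log hr, le_div_iff₀ hr] at h
    nlinarith

lemma dual_bound {S : Type*} [MeasurableSpace S] {ν μ : Measure S} [IsFiniteMeasure μ]
    [IsFiniteMeasure ν] {α : ℝ} (hα : 0 ≤ α) (h : relEnt ν μ ≤ ENNReal.ofReal α)
    (g : S → ℝ) (hg : Measurable g) (hb : ∃ C : ℝ, ∀ x, |g x| ≤ C) :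
    ∫ x, g x ∂ν ≤ α + ∫ x, (Real.exp (g x) - 1) ∂μ := by
  obtain ⟨C, hC⟩ := hb
  have hac := ac_of_relEnt h
  rw [relEnt_of_ac hac] at h
  have hgν : Integrable g ν := Integrable.of_bound hg.aestronglyMeasurable C (ae_of_all _ hC)
  have hint : Integrable (fun x => (ν.rnDeriv μ x).toReal • g x) μ :=
    (integrable_rnDeriv_smul_iff hac).2 hgν
  have hkm : Measurable (fun x => InformationTheory.klFun (ν.rnDeriv μ x).toReal) :=
    InformationTheory.measurable_klFun.comp (Measure.measurable_rnDeriv _ _).ennreal_toReal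
  have hk0 : ∀ x, 0 ≤ InformationTheory.klFun (ν.rnDeriv μ x).toReal :=
    fun x => InformationTheory.klFun_nonneg ENNReal.toReal_nonneg
  have hki : Integrable (fun x => InformationTheory.klFun (ν.rnDeriv μ x).toReal) μ := by
    refine ⟨hkm.aestronglyMeasurable, ?_⟩
    rw [hasFiniteIntegral_iff_ofReal (ae_of_all _ hk0)]
    exact h.trans_lt ENNReal.ofReal_lt_top
  have hkα : ∫ x, InformationTheory.klFun (ν.rnDeriv μ x).toReal ∂μ ≤ α := by
    rw [integral_eq_lintegral_of_nonneg_ae (ae_of_all _ hk0) hkm.aestronglyMeasurable]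
    exact ENNReal.toReal_le_of_le_ofReal hα h
  have hei : Integrable (fun x => Real.exp (g x) - 1) μ := by
    refine Integrable.sub (Integrable.of_bound hg.exp.aestronglyMeasurable (Real.exp C)
      (ae_of_all _ fun x => ?_)) (integrable_const _)
    rw [Real.norm_of_nonneg (Real.exp_pos _).le]
    exact Real.exp_le_exp.2 (abs_le.1 (hC x)).2
  rw [← integral_rnDeriv_smul hac]
  calc _ ≤ ∫ x, (InformationTheory.klFun (ν.rnDeriv μ x).toReal + (Real.exp (g x) - 1)) ∂μ :=
        integral_mono hint (hki.add hei) (fun x => young _ _ ENNReal.toReal_nonneg)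
    _ = _ := integral_add hki hei
    _ ≤ _ := by linarith

lemma relEnt_le_of_dual {S : Type*} [MeasurableSpace S] {ν μ : Measure S} [IsFiniteMeasure μ]
    [IsFiniteMeasure ν] {α : ℝ} (hac : ν ≪ μ)
    (h : ∀ g : S → ℝ, Measurable g → (∃ C : ℝ, ∀ x, |g x| ≤ C) →
      ∫ x, g x ∂ν ≤ α + ∫ x, (Real.exp (g x) - 1) ∂μ) :
    relEnt ν μ ≤ ENNReal.ofReal α := by
  rw [relEnt_of_ac hac]
  set r : S → ℝ := fun x => (ν.rnDeriv μ x).toReal with hr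
  have hr0 : ∀ x, 0 ≤ r x := fun x => ENNReal.toReal_nonneg
  have hrm : Measurable r := (Measure.measurable_rnDeriv _ _).ennreal_toReal
  let c : ℕ → S → ℝ := fun n x => max (1 / ((n : ℝ) + 1)) (min (r x) ((n : ℝ) + 1))
  have hcm : ∀ n, Measurable (c n) := fun n =>
    measurable_const.max (hrm.min measurable_const)
  have hn1 : ∀ n : ℕ, (1 : ℝ) / ((n : ℝ) + 1) ≤ 1 := fun n => by
    rw [div_le_one (by positivity)]; linarith [(Nat.cast_nonneg n : (0:ℝ) ≤ n)]
  have hn2 : ∀ n : ℕ, (1 : ℝ) ≤ (n : ℝ) + 1 := fun n => by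
    linarith [(Nat.cast_nonneg n : (0:ℝ) ≤ n)]
  have hclb : ∀ (n : ℕ) x, 1 / ((n : ℝ) + 1) ≤ c n x := fun n x => le_max_left _ _
  have hcub : ∀ (n : ℕ) x, c n x ≤ (n : ℝ) + 1 := fun n x =>
    max_le ((hn1 n).trans (hn2 n)) (min_le_right _ _)
  have hcpos : ∀ n x, 0 < c n x := fun n x => lt_of_lt_of_le (by positivity) (hclb n x)
  let F : ℕ → S → ℝ := fun n x => r x * Real.log (c n x) - (c n x - 1)
  have hF0 : ∀ n x, 0 ≤ F n x := by
    intro n x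
    have h1 := InformationTheory.klFun_nonneg (hcpos n x).le
    rw [InformationTheory.klFun_apply] at h1
    have h2 : 0 ≤ (r x - c n x) * Real.log (c n x) := by
      rcases le_total 1 (r x) with h | h
      · have h3 : 1 ≤ c n x := (le_min h (hn2 n)).trans (le_max_right _ _)
        have h4 : c n x ≤ r x := max_le ((hn1 n).trans h) (min_le_left _ _)
        exact mul_nonneg (by linarith) (Real.log_nonneg h3)
      · have h3 : c n x ≤ 1 := max_le (hn1 n) ((min_le_left _ _).trans h)
        have h4 : r x ≤ c n x := (le_min le_rfl (h.trans (hn2 n))).trans (le_max_right _ _)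
        exact mul_nonneg_of_nonpos_of_nonpos (by linarith)
          (Real.log_nonpos (hcpos n x).le h3)
    show 0 ≤ r x * Real.log (c n x) - (c n x - 1)
    linarith
  have hFm : ∀ n, Measurable (F n) := fun n =>
    (hrm.mul (hcm n).log).sub ((hcm n).sub measurable_const)
  have hFint : ∀ n, ∫⁻ x, ENNReal.ofReal (F n x) ∂μ ≤ ENNReal.ofReal α := by
    intro n
    have hb : ∀ x, |Real.log (c n x)| ≤ Real.log ((n : ℝ) + 1) := by
      intro x
      rw [abs_le]
      constructor
      · have := Real.log_le_log (by positivity) (hclb n x)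
        rwa [one_div, Real.log_inv] at this
      · exact Real.log_le_log (hcpos n x) (hcub n x)
    have h1 := h (fun x => Real.log (c n x)) (hcm n).log ⟨_, hb⟩
    have hgν : Integrable (fun x => Real.log (c n x)) ν :=
      Integrable.of_bound (hcm n).log.aestronglyMeasurable _ (ae_of_all _ hb)
    have hint : Integrable (fun x => r x * Real.log (c n x)) μ :=
      (integrable_rnDeriv_smul_iff hac).2 hgν
    have hci : Integrable (fun x => c n x - 1) μ := by
      refine Integrable.sub (Integrable.of_bound (hcm n).aestronglyMeasurable ((n : ℝ) + 1)
        (ae_of_all _ fun x => ?_)) (integrable_const _)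
      rw [Real.norm_of_nonneg (hcpos n x).le]
      exact hcub n x
    have h2 : ∫ x, r x * Real.log (c n x) ∂μ = ∫ x, Real.log (c n x) ∂ν :=
      integral_rnDeriv_smul hac
    simp only [Real.exp_log (hcpos n _)] at h1
    rw [← ofReal_integral_eq_lintegral_ofReal (f := F n) (hint.sub hci) (ae_of_all _ (hF0 n))]
    refine ENNReal.ofReal_le_ofReal ?_
    have h3 : ∫ x, F n x ∂μ = _ := integral_sub hint hci
    show ∫ x, F n x ∂μ ≤ α
    rw [h3, h2]
    linarith
  have hFlim : ∀ x, Tendsto (fun n => ENNReal.ofReal (F n x)) atTop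
      (𝓝 (ENNReal.ofReal (InformationTheory.klFun (r x)))) := by
    intro x
    refine ENNReal.tendsto_ofReal ?_
    have hinv : Tendsto (fun n : ℕ => 1 / ((n : ℝ) + 1)) atTop (𝓝 0) :=
      tendsto_one_div_add_atTop_nhds_zero_nat
    rcases (hr0 x).eq_or_lt with h0 | h0
    · have : ∀ n, F n x = 1 - 1 / ((n : ℝ) + 1) := by
        intro n
        have hp : (0 : ℝ) < 1 / ((n : ℝ) + 1) := by positivity
        have hc : c n x = 1 / ((n : ℝ) + 1) := by
          show max (1 / ((n : ℝ) + 1)) (min (r x) ((n : ℝ) + 1)) = _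
          rw [← h0, max_eq_left]
          exact (min_le_left _ _).trans hp.le
        show r x * Real.log (c n x) - (c n x - 1) = _
        rw [hc, ← h0]; ring
      simp only [this]
      rw [← h0, InformationTheory.klFun_zero]
      simpa using tendsto_const_nhds.sub hinv
    · refine tendsto_const_nhds.congr' ?_
      have hbig : ∀ᶠ n : ℕ in atTop, r x ≤ n :=
        tendsto_natCast_atTop_atTop.eventually_ge_atTop (r x)
      filter_upwards [hbig, hinv.eventually (gt_mem_nhds h0)] with n h1 h2
      have hc : c n x = r x := by
        show max (1 / ((n : ℝ) + 1)) (min (r x) ((n : ℝ) + 1)) = _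
        rw [min_eq_left (by linarith), max_eq_right h2.le]
      show _ = r x * Real.log (c n x) - (c n x - 1)
      rw [hc, InformationTheory.klFun_apply]; ring
  calc ∫⁻ x, ENNReal.ofReal (InformationTheory.klFun (r x)) ∂μ
      = ∫⁻ x, liminf (fun n => ENNReal.ofReal (F n x)) atTop ∂μ :=
        lintegral_congr fun x => (hFlim x).liminf_eq.symm
    _ ≤ liminf (fun n => ∫⁻ x, ENNReal.ofReal (F n x) ∂μ) atTop :=
        lintegral_liminf_le fun n => (hFm n).ennreal_ofReal
    _ ≤ ENNReal.ofReal α := by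
        refine (liminf_le_liminf (Eventually.of_forall hFint)).trans ?_
        simp

/-- Sequential compactness of entropy level sets in the setwise
(τ-)topology: any sequence of finite measures with `h(ν_n|μ) ≤ α` has a subsequence converging
on every bounded measurable function to a limit `ν` with `h(ν|μ) ≤ α`. -/
theorem statement16 {S : Type*} [MeasurableSpace S] (μ : Measure S) [IsFiniteMeasure μ]
    (α : ℝ) (hα : 0 ≤ α) (ν : ℕ → Measure S) (hfin : ∀ k, IsFiniteMeasure (ν k))
    (hent : ∀ k, relEnt (ν k) μ ≤ ENNReal.ofReal α) :
    ∃ φ : ℕ → ℕ, StrictMono φ ∧ ∃ νlim : Measure S, IsFiniteMeasure νlim ∧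
      relEnt νlim μ ≤ ENNReal.ofReal α ∧
      (∀ g : S → ℝ, Measurable g → (∃ C : ℝ, ∀ x, |g x| ≤ C) →
        Tendsto (fun k => ∫ x, g x ∂(ν (φ k))) atTop (𝓝 (∫ x, g x ∂νlim))) ∧
      ∀ E : Set S, MeasurableSet E →
        Tendsto (fun k => ((ν (φ k)) E).toReal) atTop (𝓝 ((νlim E).toReal)) := by
  obtain ⟨φ, hφ, hlim⟩ := setwise_subseq μ α hα ν hfin hent
  obtain ⟨νl, hνl, hac, hset⟩ := setwise_limit μ α hα (fun k => ν (φ k)) (fun k => hfin _)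
    (fun k => hent _) hlim
  have hb := bounded_conv (fun k => ν (φ k)) (fun k => hfin _) νl hset
  refine ⟨φ, hφ, νl, hνl, ?_, hb, hset⟩
  refine relEnt_le_of_dual hac fun g hg hgb => ?_
  exact le_of_tendsto (hb g hg hgb)
    (Eventually.of_forall fun k => dual_bound hα (hent (φ k)) g hg hgb)

end
end
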